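/- arXiv:1804.01347 — 7 statements merged into one kernel-verified Lean document; each statement's English description precedes it below -/
import Mathlib

section
/- Let ν ∈ ℝ and set κ = ν² − 1/4. Let p : (0,∞)×(0,1)×(0,1) → ℝ be such that for each fixed y ∈ (0,1) the map (t,x) ↦ p_t(x,y) is C¹ in t and C² in x, and satisfies the heat equation ∂_t p_t(x,y) = ∂²_x p_t(x,y) − (κ/x²) p_t(x,y) on (0,∞)×(0,1). Assume there are constants A, c > 0 such that for all x, y ∈ (0,1) and t > 0: |p_t(x,y)| ≤ A t^{−1/2} e^{−(x−y)²/(ct)}, |t ∂_t p_t(x,y)| ≤ A t^{−1/2} e^{−(x−y)²/(ct)}, and |∂_x p_t(x,y)| ≤ A (t^{−1} + x^{−1} t^{−1/2}) e^{−(x−y)²/(ct)}. Then there exists C' > 0, depending only on A, c, κ, such that for every interval I = (x_I − r_I, x_I + r_I) with x_I ∈ (0,1) and 0 < r_I ≤ (1/3) min{x_I, 1−x_I}, every y with |y − x_I| < r_I/2, and every t > 0: |∫_I t ∂_t p_t(x,y) dx| ≤ C' t / r_I². -/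
open MeasureTheory

lemma aux_gauss (c t y a b : ℝ) (hc : 0 < c) (ht : 0 < t) (hab : a ≤ b) :
    ∫ x in a..b, t ^ (-(1/2) : ℝ) * Real.exp (-(x-y)^2 / (c*t)) ≤ Real.sqrt (Real.pi * c) := by
  have hct : 0 < c * t := mul_pos hc ht
  have e : (fun x : ℝ => Real.exp (-(x-y)^2 / (c*t))) =
      fun x : ℝ => (fun u : ℝ => Real.exp (-(c*t)⁻¹ * u^2)) (x - y) := by
    funext x
    simp only
    congr 1
    field_simp
  have hi0 : Integrable (fun u : ℝ => Real.exp (-(c*t)⁻¹ * u^2)) :=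
    integrable_exp_neg_mul_sq (inv_pos.2 hct)
  have hi : Integrable (fun x : ℝ => Real.exp (-(x-y)^2 / (c*t))) := by
    rw [e]; exact hi0.comp_sub_right y
  have hI : ∫ x : ℝ, Real.exp (-(x-y)^2 / (c*t)) = Real.sqrt (Real.pi * c) * Real.sqrt t := by
    rw [e, integral_sub_right_eq_self (fun u : ℝ => Real.exp (-(c*t)⁻¹ * u^2)) y,
      integral_gaussian, ← Real.sqrt_mul (by positivity)]
    congr 1
    field_simp
  rw [intervalIntegral.integral_const_mul, intervalIntegral.integral_of_le hab]
  have h1 : ∫ x in Set.Ioc a b, Real.exp (-(x-y)^2 / (c*t)) ≤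
      Real.sqrt (Real.pi * c) * Real.sqrt t := by
    rw [← hI]
    exact setIntegral_le_integral hi (Filter.Eventually.of_forall fun x => (Real.exp_pos _).le)
  have hs : t ^ (-(1/2) : ℝ) = (Real.sqrt t)⁻¹ := by
    rw [Real.rpow_neg ht.le, Real.sqrt_eq_rpow]
  have hsp : 0 < Real.sqrt t := Real.sqrt_pos.2 ht
  rw [hs]
  calc _ ≤ (Real.sqrt t)⁻¹ * (Real.sqrt (Real.pi * c) * Real.sqrt t) := by gcongr
    _ = _ := by field_simp

lemma aux_bdry (A c t r x d : ℝ) (hA : 0 < A) (hc : 0 < c) (ht : 0 < t) (hr : 0 < r)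
    (hx : r ≤ x) (hd : r / 2 ≤ |d|) :
    A * (t⁻¹ + x⁻¹ * t ^ (-(1/2) : ℝ)) * Real.exp (-d^2 / (c*t)) ≤ A * (8*c+1) / r^2 := by
  have hct : 0 < c * t := mul_pos hc ht
  have hs : t ^ (-(1/2) : ℝ) = (Real.sqrt t)⁻¹ := by
    rw [Real.rpow_neg ht.le, Real.sqrt_eq_rpow]
  have hsp : 0 < Real.sqrt t := Real.sqrt_pos.2 ht
  have hd2 : r^2/4 ≤ d^2 := by
    rw [← sq_abs d]; nlinarith
  have h1 : x⁻¹ * t ^ (-(1/2) : ℝ) ≤ t⁻¹ + (r^2)⁻¹ := by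
    have h2 : x⁻¹ ≤ r⁻¹ := inv_anti₀ hr hx
    rw [hs]
    have h3 : t⁻¹ = (Real.sqrt t)⁻¹^2 := by rw [inv_pow, Real.sq_sqrt ht.le]
    have h4 : (r^2)⁻¹ = r⁻¹^2 := by rw [inv_pow]
    rw [h3, h4]
    have h5 : 0 < (Real.sqrt t)⁻¹ := inv_pos.2 hsp
    have h6 : 0 < r⁻¹ := inv_pos.2 hr
    nlinarith [sq_nonneg ((Real.sqrt t)⁻¹ - r⁻¹), mul_le_mul_of_nonneg_right h2 h5.le, mul_pos h5 h6]
  have hE1 : Real.exp (-d^2 / (c*t)) ≤ 1 := by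
    rw [Real.exp_le_one_iff, neg_div]
    have : 0 ≤ d^2/(c*t) := by positivity
    linarith
  have hE2 : t⁻¹ * Real.exp (-d^2 / (c*t)) ≤ 4*c/r^2 := by
    have hu : r^2/(4*(c*t)) ≤ d^2/(c*t) := by
      rw [div_le_div_iff₀ (by positivity) hct]; nlinarith
    have hup : 0 < r^2/(4*(c*t)) := by positivity
    have hexp : r^2/(4*(c*t)) ≤ Real.exp (d^2/(c*t)) := by
      linarith [Real.add_one_le_exp (d^2/(c*t))]
    have : Real.exp (-d^2 / (c*t)) ≤ (r^2/(4*(c*t)))⁻¹ := by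
      rw [neg_div, Real.exp_neg]; exact inv_anti₀ hup hexp
    calc _ ≤ t⁻¹ * (r^2/(4*(c*t)))⁻¹ := by gcongr
      _ = _ := by field_simp
  have hEp := Real.exp_pos (-d^2 / (c*t))
  have hrp : 0 < (r^2)⁻¹ := by positivity
  have h7 : (t⁻¹ + x⁻¹ * t ^ (-(1/2) : ℝ)) * Real.exp (-d^2 / (c*t)) ≤ (8*c+1) / r^2 := by
    calc _ ≤ (t⁻¹ + (t⁻¹ + (r^2)⁻¹)) * Real.exp (-d^2 / (c*t)) := by gcongr
      _ = 2 * (t⁻¹ * Real.exp (-d^2 / (c*t))) + (r^2)⁻¹ * Real.exp (-d^2 / (c*t)) := by ring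
      _ ≤ 2 * (4*c/r^2) + (r^2)⁻¹ * 1 := by gcongr
      _ = _ := by ring
  calc _ = A * ((t⁻¹ + x⁻¹ * t ^ (-(1/2) : ℝ)) * Real.exp (-d^2 / (c*t))) := by ring
    _ ≤ A * ((8*c+1) / r^2) := by gcongr
    _ = _ := by ring

/-- For the heat kernel of the Fourier–Bessel operator
`L = -d²/dx² + (ν²-1/4)/x²` on `L²((0,1),dx)` (encoded through the heat equation
and standard Gaussian-type bounds), the kernel `q_t = t ∂_t p_t` of `-tLe^{-tL}`
satisfies `|∫_I q_t(x,y) dx| ≤ C' t / r_I²` for subcritical intervals `I` and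
`y ∈ (1/2)I`, with `C'` depending only on `A, c, κ`. -/
theorem bessel_dx_Qt_interval_estimate (ν κ A c : ℝ)
    (hκ : κ = ν^2 - 1/4) (hA : 0 < A) (hc : 0 < c) :
    ∃ C' : ℝ, 0 < C' ∧
    ∀ p pt px pxx : ℝ → ℝ → ℝ → ℝ,
      (∀ y ∈ Set.Ioo (0:ℝ) 1, ∀ x ∈ Set.Ioo (0:ℝ) 1, ∀ t : ℝ, 0 < t →
        HasDerivAt (fun s => p s x y) (pt t x y) t) →
      (∀ y ∈ Set.Ioo (0:ℝ) 1, ∀ x ∈ Set.Ioo (0:ℝ) 1, ∀ t : ℝ, 0 < t →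
        ContinuousOn (fun s => pt s x y) (Set.Ioi 0)) →
      (∀ y ∈ Set.Ioo (0:ℝ) 1, ∀ t : ℝ, 0 < t → ∀ x ∈ Set.Ioo (0:ℝ) 1,
        HasDerivAt (fun u => p t u y) (px t x y) x) →
      (∀ y ∈ Set.Ioo (0:ℝ) 1, ∀ t : ℝ, 0 < t → ∀ x ∈ Set.Ioo (0:ℝ) 1,
        HasDerivAt (fun u => px t u y) (pxx t x y) x) →
      (∀ y ∈ Set.Ioo (0:ℝ) 1, ∀ t : ℝ, 0 < t →
        ContinuousOn (fun x => pxx t x y) (Set.Ioo 0 1)) →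
      (∀ y ∈ Set.Ioo (0:ℝ) 1, ∀ x ∈ Set.Ioo (0:ℝ) 1, ∀ t : ℝ, 0 < t →
        pt t x y = pxx t x y - (κ / x^2) * p t x y) →
      (∀ x ∈ Set.Ioo (0:ℝ) 1, ∀ y ∈ Set.Ioo (0:ℝ) 1, ∀ t : ℝ, 0 < t →
        |p t x y| ≤ A * t ^ (-(1/2) : ℝ) * Real.exp (-(x-y)^2 / (c*t)) ∧
        |t * pt t x y| ≤ A * t ^ (-(1/2) : ℝ) * Real.exp (-(x-y)^2 / (c*t)) ∧
        |px t x y| ≤ A * (t⁻¹ + x⁻¹ * t ^ (-(1/2) : ℝ)) * Real.exp (-(x-y)^2 / (c*t))) →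
      ∀ xI ∈ Set.Ioo (0:ℝ) 1, ∀ rI : ℝ, 0 < rI → rI ≤ (1/3) * min xI (1 - xI) →
      ∀ y : ℝ, |y - xI| < rI / 2 → ∀ t : ℝ, 0 < t →
        |∫ x in Set.Ioo (xI - rI) (xI + rI), t * pt t x y| ≤ C' * t / rI^2 := by
  refine ⟨2 * (A * (8*c+1)) + |κ| * A * Real.sqrt (Real.pi * c), by positivity, ?_⟩
  intro p pt px pxx _ _ hpx hpxx hcont heq hbd xI hxI r hr hr3 y hy t ht
  have hr1 : 3 * r ≤ xI := by linarith [min_le_left xI (1 - xI)]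
  have hr2 : 3 * r ≤ 1 - xI := by linarith [min_le_right xI (1 - xI)]
  obtain ⟨hy1, hy2⟩ := abs_lt.1 hy
  have hyI : y ∈ Set.Ioo (0:ℝ) 1 := ⟨by linarith, by linarith⟩
  have hab : xI - r ≤ xI + r := by linarith
  have hsub : Set.Icc (xI - r) (xI + r) ⊆ Set.Ioo (0:ℝ) 1 :=
    fun x hx => ⟨by linarith [hx.1], by linarith [hx.2]⟩
  have hu : Set.uIcc (xI - r) (xI + r) = Set.Icc (xI - r) (xI + r) := Set.uIcc_of_le hab
  have hi1 : IntervalIntegrable (fun x => pxx t x y) volume (xI - r) (xI + r) := by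
    apply ContinuousOn.intervalIntegrable
    rw [hu]; exact (hcont y hyI t ht).mono hsub
  have hi2 : IntervalIntegrable (fun x => κ / x^2 * p t x y) volume (xI - r) (xI + r) := by
    apply ContinuousOn.intervalIntegrable
    rw [hu]
    apply ContinuousOn.mul
    · exact continuousOn_const.div (by fun_prop) fun x hx => pow_ne_zero _ (hsub hx).1.ne'
    · exact fun x hx => (hpx y hyI t ht x (hsub hx)).continuousAt.continuousWithinAt
  have hftc : ∫ x in (xI - r)..(xI + r), pxx t x y = px t (xI + r) y - px t (xI - r) y := by
    apply intervalIntegral.integral_eq_sub_of_hasDerivAt (f := fun x => px t x y) _ hi1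
    intro x hx
    rw [hu] at hx
    exact hpxx y hyI t ht x (hsub hx)
  have hmain : ∫ x in Set.Ioo (xI - r) (xI + r), t * pt t x y =
      t * ((px t (xI + r) y - px t (xI - r) y) - ∫ x in (xI - r)..(xI + r), κ / x^2 * p t x y) := by
    rw [← integral_Ioc_eq_integral_Ioo, ← intervalIntegral.integral_of_le hab,
      intervalIntegral.integral_const_mul, ← hftc, ← intervalIntegral.integral_sub hi1 hi2]
    congr 1
    apply intervalIntegral.integral_congr
    intro x hx
    rw [hu] at hx
    exact heq y hyI x (hsub hx) t ht
  have hb1 : |px t (xI + r) y| ≤ A * (8*c+1) / r^2 :=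
    (hbd (xI + r) (hsub ⟨hab, le_rfl⟩) y hyI t ht).2.2.trans
      (aux_bdry A c t r _ _ hA hc ht hr (by linarith) (le_abs.2 (Or.inl (by linarith))))
  have hb2 : |px t (xI - r) y| ≤ A * (8*c+1) / r^2 :=
    (hbd (xI - r) (hsub ⟨le_rfl, hab⟩) y hyI t ht).2.2.trans
      (aux_bdry A c t r _ _ hA hc ht hr (by linarith) (le_abs.2 (Or.inr (by linarith))))
  have hb3 : |∫ x in (xI - r)..(xI + r), κ / x^2 * p t x y| ≤
      |κ| * A * Real.sqrt (Real.pi * c) / r^2 := by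
    have h1 : |∫ x in (xI - r)..(xI + r), κ / x^2 * p t x y| ≤
        ∫ x in (xI - r)..(xI + r),
          (|κ| * A / r^2) * (t ^ (-(1/2) : ℝ) * Real.exp (-(x-y)^2 / (c*t))) := by
      rw [← Real.norm_eq_abs]
      apply intervalIntegral.norm_integral_le_of_norm_le hab
      · refine Filter.Eventually.of_forall fun x hx => ?_
        have hx' := hsub ⟨hx.1.le, hx.2⟩
        have hrx : r ≤ x := by linarith [hx.1]
        rw [Real.norm_eq_abs, abs_mul, abs_div, abs_of_nonneg (sq_nonneg x)]
        calc |κ| / x^2 * |p t x y|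
            ≤ |κ| / r^2 * (A * t ^ (-(1/2) : ℝ) * Real.exp (-(x-y)^2 / (c*t))) := by
              have := (hbd x hx' y hyI t ht).1
              gcongr
          _ = _ := by ring
      · apply Continuous.intervalIntegrable
        fun_prop
    rw [intervalIntegral.integral_const_mul] at h1
    refine h1.trans ?_
    calc _ ≤ (|κ| * A / r^2) * Real.sqrt (Real.pi * c) := by
          gcongr
          exact aux_gauss c t y _ _ hc ht hab
      _ = _ := by ring
  rw [hmain, abs_mul, abs_of_pos ht]
  have h := abs_sub (px t (xI + r) y - px t (xI - r) y)
    (∫ x in (xI - r)..(xI + r), κ / x^2 * p t x y)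
  have h' := abs_sub (px t (xI + r) y) (px t (xI - r) y)
  calc _ ≤ t * (A * (8*c+1) / r^2 + A * (8*c+1) / r^2 +
        |κ| * A * Real.sqrt (Real.pi * c) / r^2) := by
        gcongr
        linarith
    _ = _ := by ring
end

section
/- Let ν > −1 and let μ_ν be the measure on (0,1) with density x^{2ν+1} with respect to Lebesgue measure. Let p : (0,∞)×(0,1)×(0,1) → ℝ be such that for each fixed y the map (t,x) ↦ p_t(x,y) is C¹ in t and C² in x and satisfies ∂_t p_t(x,y) = ∂²_x p_t(x,y) + ((2ν+1)/x) ∂_x p_t(x,y). Assume there are constants A, c > 0 such that for all x, y ∈ (0,1) and t > 0: |t ∂_t p_t(x,y)| ≤ A μ_ν(I_{√t}(x))^{−1} e^{−(x−y)²/(ct)} and |∂_x p_t(x,y)| ≤ A (xy)^{−(ν+1/2)} t^{−1} e^{−(x−y)²/(ct)}, where I_{√t}(x) = (x−√t, x+√t) ∩ (0,1). Then there exist constants C', c' > 0, depending only on A, c, ν, such that for every x_I ∈ (1/2,1), setting ρ_I = (1−x_I)/3 and I = (x_I − ρ_I, x_I + ρ_I), and every y with |y − x_I| < ρ_I/2 and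 every t > 0: |∫_I t ∂_t p_t(x,y) dμ_ν(x)| ≤ C' (t^{1/4}/√ρ_I) e^{−c' ρ_I²/t}. -/
open MeasureTheory

/-- The measure on `(0,1)` with density `x^{2ν+1}` with respect to Lebesgue measure. -/
noncomputable def muBessel01 (ν : ℝ) : Measure ℝ :=
  (volume.restrict (Set.Ioo 0 1)).withDensity (fun x => ENNReal.ofReal (x ^ (2*ν+1)))

lemma bessel_int_eq (ν a b : ℝ) (ha : 0 < a) (hab : a ≤ b) (hb : b < 1)
    (f g h : ℝ → ℝ)
    (hg : ∀ x ∈ Set.Ioo (0:ℝ) 1, HasDerivAt g (h x) x)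
    (hh : ContinuousOn h (Set.Ioo 0 1))
    (hf : ∀ x ∈ Set.Ioo (0:ℝ) 1, f x = h x + ((2*ν+1)/x) * g x) (t : ℝ) :
    ∫ x in Set.Ioo a b, t * f x ∂(muBessel01 ν)
      = t * (b ^ (2*ν+1) * g b - a ^ (2*ν+1) * g a) := by
  have hsub : Set.Ioo a b ⊆ Set.Ioo 0 1 := fun x hx => ⟨ha.trans hx.1, hx.2.trans hb⟩
  have hsub' : Set.Icc a b ⊆ Set.Ioo 0 1 :=
    fun x hx => ⟨ha.trans_le hx.1, hx.2.trans_lt hb⟩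
  have hmeas : Measurable (fun x : ℝ => ENNReal.ofReal (x ^ (2*ν+1))) := by fun_prop
  unfold muBessel01
  rw [setIntegral_withDensity_eq_setIntegral_toReal_smul hmeas
    (Filter.Eventually.of_forall fun x => ENNReal.ofReal_lt_top) _ measurableSet_Ioo,
    Measure.restrict_restrict measurableSet_Ioo, Set.inter_eq_left.mpr hsub]
  have hder : ∀ x ∈ Set.Ioo (0:ℝ) 1, HasDerivAt (fun x => t * (x ^ (2*ν+1) * g x))
      (t * (((2*ν+1) * x ^ (2*ν+1-1)) * g x + x ^ (2*ν+1) * h x)) x := by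
    intro x hx
    exact ((Real.hasDerivAt_rpow_const (Or.inl hx.1.ne')).mul (hg x hx)).const_mul t
  have hgc : ContinuousOn g (Set.Ioo 0 1) :=
    fun x hx => (hg x hx).continuousAt.continuousWithinAt
  have hcont : ContinuousOn (fun x => t * (((2*ν+1) * x ^ (2*ν+1-1)) * g x + x ^ (2*ν+1) * h x))
      (Set.Icc a b) := by
    have hp : ∀ r : ℝ, ContinuousOn (fun x : ℝ => x ^ r) (Set.Icc a b) := fun r =>
      ContinuousOn.rpow_const continuousOn_id (fun x hx => Or.inl (hsub' hx).1.ne')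
    exact continuousOn_const.mul (((continuousOn_const.mul (hp _)).mul (hgc.mono hsub')).add
      ((hp _).mul (hh.mono hsub')))
  have key := intervalIntegral.integral_eq_sub_of_hasDerivAt (a := a) (b := b)
    (f := fun x => t * (x ^ (2*ν+1) * g x))
    (fun x hx => hder x (hsub' (by rwa [Set.uIcc_of_le hab] at hx)))
    (ContinuousOn.intervalIntegrable (by rwa [Set.uIcc_of_le hab]))
  rw [intervalIntegral.integral_of_le hab, integral_Ioc_eq_integral_Ioo] at key
  rw [mul_sub, ← key]
  refine setIntegral_congr_fun measurableSet_Ioo fun x hx => ?_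
  have hx0 : 0 < x := (hsub hx).1
  simp only [smul_eq_mul]
  rw [ENNReal.toReal_ofReal (Real.rpow_nonneg hx0.le _), hf x (hsub hx), Real.rpow_sub_one hx0.ne']
  field_simp
  ring

lemma bessel_weight (ν x y : ℝ) (hx : 1/3 < x) (hx1 : x < 1) (hy : 1/3 < y) (hy1 : y < 1) :
    x ^ (2*ν+1) * (x*y) ^ (-(ν+1/2)) ≤ 3 ^ |ν+1/2| := by
  have hx0 : 0 < x := by linarith
  have hy0 : 0 < y := by linarith
  have e : x ^ (2*ν+1) * (x*y) ^ (-(ν+1/2)) = (x/y) ^ (ν+1/2) := by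
    rw [Real.mul_rpow hx0.le hy0.le, ← mul_assoc, ← Real.rpow_add hx0,
      Real.div_rpow hx0.le hy0.le, Real.rpow_neg hy0.le, div_eq_mul_inv]
    congr 2
    ring
  rw [e]
  rcases le_total 0 (ν+1/2) with h | h
  · rw [abs_of_nonneg h]
    refine Real.rpow_le_rpow (by positivity) ?_ h
    rw [div_le_iff₀ hy0]; linarith
  · rw [abs_of_nonpos h, ← neg_neg (ν+1/2), Real.rpow_neg (by positivity), neg_neg,
      ← Real.inv_rpow (by positivity), inv_div]
    refine Real.rpow_le_rpow (by positivity) ?_ (by linarith)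
    rw [div_le_iff₀ hx0]; linarith

lemma bessel_exp (c ρ t : ℝ) (hc : 0 < c) (hρ : 0 < ρ) (ht : 0 < t) :
    Real.exp (-(ρ/2)^2 / (c*t)) ≤ (8*c) ^ ((1:ℝ)/4) * (t ^ ((1:ℝ)/4) / Real.sqrt ρ) *
      Real.exp (-(1/(8*c)) * ρ^2 / t) := by
  set v : ℝ := ρ^2 / (8*c*t) with hv
  have hv0 : 0 < v := by positivity
  have e1 : -(ρ/2)^2 / (c*t) = -v + -v := by rw [hv]; field_simp; ring
  have e2 : -(1/(8*c)) * ρ^2 / t = -v := by rw [hv]; field_simp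
  have e3 : (8*c) ^ ((1:ℝ)/4) * (t ^ ((1:ℝ)/4) / Real.sqrt ρ) = (v ^ ((1:ℝ)/4))⁻¹ := by
    rw [hv, Real.div_rpow (by positivity) (by positivity),
      Real.mul_rpow (by positivity) ht.le, inv_div, mul_div_assoc]
    congr 2
    rw [Real.sqrt_eq_rpow, ← Real.rpow_natCast, ← Real.rpow_mul hρ.le]
    norm_num
  rw [e1, e2, e3, Real.exp_add]
  refine mul_le_mul_of_nonneg_right ?_ (Real.exp_pos _).le
  rw [Real.exp_neg]
  refine inv_anti₀ (by positivity) ?_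
  have h1 : v ^ ((1:ℝ)/4) ≤ 1 + v := by
    calc v ^ ((1:ℝ)/4) ≤ (1+v) ^ ((1:ℝ)/4) :=
          Real.rpow_le_rpow hv0.le (by linarith) (by norm_num)
      _ ≤ (1+v) ^ (1:ℝ) := Real.rpow_le_rpow_of_exponent_le (by linarith) (by norm_num)
      _ = 1 + v := Real.rpow_one _
  have := Real.add_one_le_exp v
  linarith

/-- For the heat kernel of the Fourier–Bessel operator
`L = -d²/dx² - ((2ν+1)/x) d/dx` on `L²((0,1), dμ_ν)` (encoded through the heat
equation and the standard bounds), the kernel `q_t = t ∂_t p_t` of `-tLe^{-tL}`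
satisfies `|∫_{I_ρ} q_t(x,y) dμ_ν(x)| ≤ C' (t^{1/4}/√ρ_I) e^{-c' ρ_I²/t}` for
critical intervals `I_ρ` and `y ∈ (1/2)I_ρ`, with `C', c'` depending only on
`A, c, ν`. -/
theorem bessel_dmu_Qt_critical_interval_estimate (ν A c : ℝ)
    (hν : -1 < ν) (hA : 0 < A) (hc : 0 < c) :
    ∃ C' c' : ℝ, 0 < C' ∧ 0 < c' ∧
    ∀ p pt px pxx : ℝ → ℝ → ℝ → ℝ,
      (∀ y ∈ Set.Ioo (0:ℝ) 1, ∀ x ∈ Set.Ioo (0:ℝ) 1, ∀ t : ℝ, 0 < t →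
        HasDerivAt (fun s => p s x y) (pt t x y) t) →
      (∀ y ∈ Set.Ioo (0:ℝ) 1, ∀ x ∈ Set.Ioo (0:ℝ) 1, ∀ t : ℝ, 0 < t →
        ContinuousOn (fun s => pt s x y) (Set.Ioi 0)) →
      (∀ y ∈ Set.Ioo (0:ℝ) 1, ∀ t : ℝ, 0 < t → ∀ x ∈ Set.Ioo (0:ℝ) 1,
        HasDerivAt (fun u => p t u y) (px t x y) x) →
      (∀ y ∈ Set.Ioo (0:ℝ) 1, ∀ t : ℝ, 0 < t → ∀ x ∈ Set.Ioo (0:ℝ) 1,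
        HasDerivAt (fun u => px t u y) (pxx t x y) x) →
      (∀ y ∈ Set.Ioo (0:ℝ) 1, ∀ t : ℝ, 0 < t →
        ContinuousOn (fun x => pxx t x y) (Set.Ioo 0 1)) →
      (∀ y ∈ Set.Ioo (0:ℝ) 1, ∀ x ∈ Set.Ioo (0:ℝ) 1, ∀ t : ℝ, 0 < t →
        pt t x y = pxx t x y + ((2*ν+1)/x) * px t x y) →
      (∀ x ∈ Set.Ioo (0:ℝ) 1, ∀ y ∈ Set.Ioo (0:ℝ) 1, ∀ t : ℝ, 0 < t →
        |t * pt t x y| ≤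
          A * ((muBessel01 ν (Set.Ioo (x - Real.sqrt t) (x + Real.sqrt t)
                  ∩ Set.Ioo 0 1)).toReal)⁻¹ * Real.exp (-(x-y)^2 / (c*t)) ∧
        |px t x y| ≤ A * (x*y) ^ (-(ν+1/2)) * t⁻¹ * Real.exp (-(x-y)^2 / (c*t))) →
      ∀ xI ∈ Set.Ioo (1/2 : ℝ) 1, ∀ y : ℝ, |y - xI| < ((1 - xI)/3) / 2 →
      ∀ t : ℝ, 0 < t →
        |∫ x in Set.Ioo (xI - (1 - xI)/3) (xI + (1 - xI)/3), t * pt t x y ∂(muBessel01 ν)|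
          ≤ C' * (t ^ ((1:ℝ)/4) / Real.sqrt ((1 - xI)/3)) *
              Real.exp (-c' * ((1 - xI)/3)^2 / t) := by
  refine ⟨2 * A * 3 ^ |ν+1/2| * (8*c) ^ ((1:ℝ)/4), 1/(8*c), by positivity, by positivity, ?_⟩
  intro p pt px pxx _ _ _ hpx hpxx heq hbd xI hxI y hy t ht
  obtain ⟨h1, h2⟩ := hxI
  obtain ⟨hy1, hy2⟩ := abs_lt.mp hy
  set ρ : ℝ := (1 - xI)/3 with hρ
  have hρ0 : 0 < ρ := by rw [hρ]; linarith
  have hyI : y ∈ Set.Ioo (0:ℝ) 1 := ⟨by linarith, by linarith⟩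
  rw [bessel_int_eq ν (xI - ρ) (xI + ρ) (by linarith) (by linarith) (by linarith)
    (fun x => pt t x y) (fun x => px t x y) (fun x => pxx t x y)
    (fun x hx => hpx y hyI t ht x hx) (hpxx y hyI t ht)
    (fun x hx => heq y hyI x hx t ht) t]
  have bd : ∀ x : ℝ, 1/3 < x → x < 1 → (ρ/2)^2 ≤ (x-y)^2 →
      |t * (x ^ (2*ν+1) * px t x y)| ≤ A * 3 ^ |ν+1/2| * Real.exp (-(ρ/2)^2 / (c*t)) := by
    intro x hx hx1 hxy
    have hx0 : 0 < x := by linarith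
    have hb := (hbd x ⟨hx0, hx1⟩ y hyI t ht).2
    have hw := bessel_weight ν x y hx hx1 (by linarith) hyI.2
    have hp : 0 < x ^ (2*ν+1) := Real.rpow_pos_of_pos hx0 _
    have he : Real.exp (-(x-y)^2 / (c*t)) ≤ Real.exp (-(ρ/2)^2 / (c*t)) := by
      apply Real.exp_le_exp.mpr
      gcongr
    rw [abs_mul, abs_mul, abs_of_pos ht, abs_of_pos hp]
    calc t * (x ^ (2*ν+1) * |px t x y|)
        ≤ t * (x ^ (2*ν+1) * (A * (x*y) ^ (-(ν+1/2)) * t⁻¹ * Real.exp (-(x-y)^2 / (c*t)))) := by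
          gcongr
      _ = A * (x ^ (2*ν+1) * (x*y) ^ (-(ν+1/2))) * Real.exp (-(x-y)^2 / (c*t)) := by
          field_simp
      _ ≤ A * 3 ^ |ν+1/2| * Real.exp (-(ρ/2)^2 / (c*t)) := by
          gcongr
  have b1 := bd (xI + ρ) (by linarith) (by linarith) (by nlinarith)
  have b2 := bd (xI - ρ) (by linarith) (by linarith) (by nlinarith)
  have b3 := bessel_exp c ρ t hc hρ0 ht
  have hK : 0 ≤ 2 * (A * 3 ^ |ν+1/2|) := by positivity
  have b4 := mul_le_mul_of_nonneg_left b3 hK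
  rw [mul_sub]
  refine (abs_sub _ _).trans ?_
  calc _ ≤ 2 * (A * 3 ^ |ν+1/2|) * Real.exp (-(ρ/2)^2 / (c*t)) := by linarith
    _ ≤ _ := b4
    _ = _ := by ring
end

section
/- Let ν > −1/2, set δ = min{1, ν+1/2}, and let p ∈ (1/(1+δ), 1]. Let P : (0,∞)×(0,1)×(0,1) → ℝ be measurable and suppose there are constants A, c > 0 such that |P_t(x,y)| ≤ A ((xy)/(t+xy))^{ν+1/2} t^{−1/2} min{1, (1−x)(1−y)/t} e^{−(x−y)²/(ct)} for all x, y ∈ (0,1) and t > 0. For j ∈ ℤ∖{0} let a = |𝒥_j|^{−1/p} χ_{𝒥_j}. Then there exists a constant C depending only on A, c, ν, p (and not on j) such that ∫₀¹ ( sup_{t>0} |∫₀¹ P_t(x,y) a(y) dy| )^p dx ≤ C. -/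
open MeasureTheory

/-- Left endpoint of the interval `𝒥_j`. -/
noncomputable def Jlo (j : ℤ) : ℝ := if 0 < j then 1 - (2:ℝ)^(-j) else (2:ℝ)^(j-1)

/-- Right endpoint of the interval `𝒥_j`. -/
noncomputable def Jhi (j : ℤ) : ℝ := if 0 < j then 1 - (2:ℝ)^(-j-1) else (2:ℝ)^j

/-- `𝒥_j = (1-2^{-j}, 1-2^{-j-1}]` for `j ≥ 1` and `𝒥_j = (2^{j-1}, 2^j]` for `j ≤ -1`. -/
noncomputable def Jset (j : ℤ) : Set ℝ := Set.Ioc (Jlo j) (Jhi j)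

theorem bb_exp (c s m : ℝ) (hc : 0 < c) (hs : 0 < s) (hm0 : 0 ≤ m) (hm : m ≤ 2) :
    s ^ m * Real.exp (-s / c) ≤ 1 + 2 * c ^ 2 := by
  have h1 : s ^ m ≤ 1 + s ^ 2 := by
    rcases le_total s 1 with h | h
    · have := Real.rpow_le_one hs.le h hm0
      nlinarith [sq_nonneg s]
    · have := Real.rpow_le_rpow_of_exponent_le h hm
      rw [Real.rpow_two] at this
      linarith
  have hx : 0 ≤ s / c := by positivity
  have h2 := Real.quadratic_le_exp_of_nonneg hx
  have h3 : s ^ 2 = c ^ 2 * (s / c) ^ 2 := by field_simp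
  rw [neg_div, Real.exp_neg, ← div_eq_mul_inv, div_le_iff₀ (Real.exp_pos _)]
  have h4 : c ^ 2 * (s / c) ^ 2 ≤ c ^ 2 * (2 * Real.exp (s / c) - 2) := by
    apply mul_le_mul_of_nonneg_left _ (by positivity)
    nlinarith
  nlinarith [sq_nonneg c]

theorem bb_far (c δ r d t : ℝ) (hc : 0 < c) (hδ : 0 < δ) (hδ1 : δ ≤ 1) (hr : 0 < r) (hd : 0 < d)
    (ht : 0 < t) :
    (6 * r * d / t) ^ δ * t ^ (-(1/2) : ℝ) * Real.exp (-d ^ 2 / (c * t)) ≤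
      6 * (1 + 2 * c ^ 2) * ((r / d) ^ δ / d) := by
  set s := d ^ 2 / t with hs
  have hs0 : 0 < s := by positivity
  have e1 : 6 * r * d / t = 6 * (r / d) * s := by rw [hs]; field_simp
  have e2 : t ^ (-(1/2) : ℝ) = s ^ (1/2 : ℝ) / d := by
    rw [hs, Real.div_rpow (by positivity) ht.le, ← Real.sqrt_eq_rpow, Real.sqrt_sq hd.le,
      Real.rpow_neg ht.le]
    field_simp
  have e3 : -d ^ 2 / (c * t) = - s / c := by rw [hs]; field_simp
  rw [e1, e2, e3, Real.mul_rpow (by positivity) hs0.le, Real.mul_rpow (by positivity) (by positivity)]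
  have e4 : s ^ δ * s ^ (1/2 : ℝ) = s ^ (δ + 1/2) := (Real.rpow_add hs0 _ _).symm
  have h5 := bb_exp c s (δ + 1/2) hc hs0 (by linarith) (by linarith)
  have h6 : (6:ℝ) ^ δ ≤ 6 := by
    simpa using Real.rpow_le_rpow_of_exponent_le (by norm_num : (1:ℝ) ≤ 6) hδ1
  calc _ = 6 ^ δ * (s ^ (δ + 1/2) * Real.exp (-s / c)) * ((r / d) ^ δ / d) := by rw [← e4]; ring
    _ ≤ _ := by gcongr

theorem bb_vol (j : ℤ) : (volume (Jset j)).toReal = Jhi j - Jlo j ∧ 0 < Jhi j - Jlo j := by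
  have h : 0 < Jhi j - Jlo j := by
    unfold Jhi Jlo
    split_ifs
    · have : (2:ℝ) ^ (-j) = 2 * 2 ^ (-j-1) := by
        rw [zpow_sub_one₀ two_ne_zero]; ring
      have h2 : (0:ℝ) < 2 ^ (-j-1) := by positivity
      linarith
    · have : (2:ℝ) ^ j = 2 * 2 ^ (j-1) := by
        rw [zpow_sub_one₀ two_ne_zero]; ring
      have h2 : (0:ℝ) < 2 ^ (j-1) := by positivity
      linarith
  refine ⟨?_, h⟩
  rw [Jset, Real.volume_Ioc, ENNReal.toReal_ofReal h.le]

theorem bb_geom (j : ℤ) (y : ℝ) (hy : y ∈ Jset j) :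
    y ≤ 2 * (Jhi j - Jlo j) ∨ 1 - y ≤ 2 * (Jhi j - Jlo j) := by
  obtain ⟨h1, h2⟩ := hy
  unfold Jhi Jlo at *
  split_ifs at *
  · right
    have : (2:ℝ) ^ (-j) = 2 * 2 ^ (-j-1) := by
      rw [zpow_sub_one₀ two_ne_zero]; ring
    linarith
  · left
    have : (2:ℝ) ^ j = 2 * 2 ^ (j-1) := by
      rw [zpow_sub_one₀ two_ne_zero]; ring
    linarith

theorem bb_factor (μ δ r x y t : ℝ) (hδ : 0 < δ) (hδ1 : δ ≤ 1) (hδμ : δ ≤ μ) (hr : 0 < r)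
    (hx : x ∈ Set.Ioo (0:ℝ) 1) (hy : y ∈ Set.Ioo (0:ℝ) 1) (ht : 0 < t)
    (hg : y ≤ 2 * r ∨ 1 - y ≤ 2 * r) (hd : r ≤ |x - y|) :
    ((x*y)/(t + x*y)) ^ μ * min 1 ((1-x)*(1-y)/t) ≤ (6 * r * |x - y| / t) ^ δ := by
  obtain ⟨hx0, hx1⟩ := hx
  obtain ⟨hy0, hy1⟩ := hy
  have hxy : 0 < x * y := by positivity
  have hq0 : 0 < (x*y)/(t + x*y) := by positivity
  have hq1 : (x*y)/(t + x*y) ≤ 1 := by rw [div_le_one (by positivity)]; linarith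
  have hm0 : 0 < min 1 ((1-x)*(1-y)/t) := by
    apply lt_min one_pos
    have : 0 < 1 - x := by linarith
    have : 0 < 1 - y := by linarith
    positivity
  have ha := le_abs_self (x - y)
  have hb := neg_abs_le (x - y)
  rcases hg with h | h
  · calc _ ≤ ((x*y)/(t + x*y)) ^ δ * 1 := by
          apply mul_le_mul _ (min_le_left _ _) hm0.le (by positivity)
          exact Real.rpow_le_rpow_of_exponent_ge hq0 hq1 hδμ
      _ ≤ _ := by
          rw [mul_one]
          apply Real.rpow_le_rpow hq0.le _ hδ.le
          rw [div_le_div_iff₀ (by positivity) ht]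
          have : x * y ≤ (3 * |x - y|) * (2 * r) := by
            apply mul_le_mul _ h hy0.le (by positivity)
            linarith
          have h2 : 0 ≤ 6 * r * |x - y| := by positivity
          nlinarith
  · calc _ ≤ 1 * (min 1 ((1-x)*(1-y)/t)) ^ δ := by
          apply mul_le_mul _ _ hm0.le (by positivity)
          · exact Real.rpow_le_one hq0.le hq1 (by linarith)
          · simpa using Real.rpow_le_rpow_of_exponent_ge hm0 (min_le_left _ _) hδ1
      _ ≤ _ := by
          rw [one_mul]
          apply Real.rpow_le_rpow hm0.le _ hδ.le
          refine (min_le_right _ _).trans ?_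
          apply div_le_div_of_nonneg_right _ ht.le
          have : (1 - x) * (1 - y) ≤ (3 * |x - y|) * (2 * r) := by
            apply mul_le_mul _ h (by linarith) (by positivity)
            linarith
          linarith

theorem bb_max (ν A c δ w : ℝ) (hν : -(1/2 : ℝ) < ν) (hA : 0 < A) (hc : 0 < c)
    (hδ : 0 < δ) (hδ1 : δ ≤ 1) (hδμ : δ ≤ ν + 1/2) (hw : 0 ≤ w)
    (P : ℝ → ℝ → ℝ → ℝ)
    (hP : ∀ x ∈ Set.Ioo (0:ℝ) 1, ∀ y ∈ Set.Ioo (0:ℝ) 1, ∀ t : ℝ, 0 < t →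
        |P t x y| ≤ A * ((x*y)/(t + x*y)) ^ (ν + 1/2) * t ^ (-(1/2) : ℝ) *
          min 1 ((1-x)*(1-y)/t) * Real.exp (-(x-y)^2 / (c*t)))
    (j : ℤ) (x : ℝ) (hx : x ∈ Set.Ioo (0:ℝ) 1) (t : ℝ) (ht : 0 < t) :
    |∫ y in Set.Ioo (0:ℝ) 1, P t x y * (w * Set.indicator (Jset j) (fun _ => (1:ℝ)) y)| ≤
      (9 * A * (6 * (1 + 2 * c ^ 2) + √(Real.pi * c))) * w *
        (1 + |(x - Jhi j) / (Jhi j - Jlo j)|) ^ (-(1 + δ)) := by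
  obtain ⟨hvol, hr⟩ := bb_vol j
  set r := Jhi j - Jlo j with hrdef
  set u := |x - Jhi j| with hu
  have hu0 : 0 ≤ u := abs_nonneg _
  rw [abs_div, abs_of_pos hr, ← hu]
  set Z := (1 + u / r) with hZ
  have hZ1 : 1 ≤ Z := by rw [hZ]; have : 0 ≤ u / r := by positivity
                         linarith
  have hZ0 : 0 < Z := by linarith
  have h9 : (3:ℝ) ^ (1 + δ) ≤ 9 := by
    have := Real.rpow_le_rpow_of_exponent_le (by norm_num : (1:ℝ) ≤ 3) (by linarith : 1 + δ ≤ 2)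
    rw [Real.rpow_two] at this
    linarith
  rcases lt_or_ge u (2 * r) with hnear | hfar
  · -- near
    have hZ3 : Z ≤ 3 := by
      have : u / r ≤ 2 := by rw [div_le_iff₀ hr]; linarith
      rw [hZ]; linarith
    have hZp : 1 ≤ 9 * Z ^ (-(1 + δ)) := by
      rw [Real.rpow_neg hZ0.le, ← div_eq_mul_inv, le_div_iff₀ (by positivity), one_mul]
      exact (Real.rpow_le_rpow hZ0.le hZ3 (by linarith)).trans h9
    have hb : 0 < 1 / (c * t) := by positivity
    have hint : Integrable (fun y : ℝ => (w * A * t ^ (-(1/2) : ℝ)) * Real.exp (-(1/(c*t)) * (y - x)^2)) :=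
      ((integrable_exp_neg_mul_sq hb).comp_sub_right x).const_mul _
    have hval : ∫ y : ℝ, (w * A * t ^ (-(1/2) : ℝ)) * Real.exp (-(1/(c*t)) * (y - x)^2)
        = w * A * √(Real.pi * c) := by
      rw [integral_const_mul, integral_sub_right_eq_self (fun y => Real.exp (-(1/(c*t)) * y^2)) x,
        integral_gaussian]
      have : Real.pi / (1 / (c * t)) = (Real.pi * c) * t := by field_simp
      rw [this, Real.sqrt_mul (by positivity), Real.rpow_neg ht.le, ← Real.sqrt_eq_rpow]
      have : 0 < √t := Real.sqrt_pos.2 ht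
      field_simp
    have key : |∫ y in Set.Ioo (0:ℝ) 1, P t x y * (w * Set.indicator (Jset j) (fun _ => (1:ℝ)) y)|
        ≤ w * A * √(Real.pi * c) := by
      rw [← hval, ← Real.norm_eq_abs]
      refine le_trans (norm_integral_le_of_norm_le hint.integrableOn ?_)
        (setIntegral_le_integral hint (Filter.Eventually.of_forall fun y => by positivity))
      filter_upwards [ae_restrict_mem measurableSet_Ioo] with y hy
      have h1 := hP x hx y hy t ht
      have hi0 : 0 ≤ Set.indicator (Jset j) (fun _ => (1:ℝ)) y :=
        Set.indicator_nonneg (fun _ _ => zero_le_one) _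
      have hi1 : Set.indicator (Jset j) (fun _ => (1:ℝ)) y ≤ 1 :=
        Set.indicator_le_self' (fun _ _ => zero_le_one) _
      rw [Real.norm_eq_abs, abs_mul, abs_of_nonneg (mul_nonneg hw hi0)]
      have hxy : 0 < x * y := mul_pos hx.1 hy.1
      have hq1 : ((x*y)/(t + x*y)) ^ (ν + 1/2) ≤ 1 := by
        apply Real.rpow_le_one (by positivity) _ (by linarith)
        rw [div_le_one (by positivity)]; linarith
      have hm0 : 0 ≤ min 1 ((1-x)*(1-y)/t) := by
        apply le_min zero_le_one
        have : 0 < 1 - x := by linarith [hx.2]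
        have : 0 < 1 - y := by linarith [hy.2]
        positivity
      have h2 : |P t x y| ≤ A * 1 * t ^ (-(1/2) : ℝ) * 1 * Real.exp (-(x-y)^2 / (c*t)) := by
        refine h1.trans ?_
        gcongr
        exact min_le_left _ _
      have e : -(x-y)^2 / (c*t) = -(1/(c*t)) * (y - x)^2 := by ring
      rw [e] at h2
      calc _ ≤ (A * 1 * t ^ (-(1/2) : ℝ) * 1 * Real.exp (-(1/(c*t)) * (y - x)^2)) * (w * 1) := by
            gcongr
        _ = _ := by ring
    calc _ ≤ (w * A * √(Real.pi * c)) * 1 := by rw [mul_one]; exact key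
      _ ≤ (w * A * (6 * (1 + 2 * c ^ 2) + √(Real.pi * c))) * (9 * Z ^ (-(1 + δ))) := by
          gcongr
          have : 0 ≤ 6 * (1 + 2 * c ^ 2) := by positivity
          linarith
      _ = _ := by ring
  · -- far
    have hu1 : 0 < u := by linarith
    set D := A * (6 * (1 + 2 * c ^ 2) * ((r / (u/2)) ^ δ / (u/2))) with hD
    have hD0 : 0 ≤ D := by positivity
    have hmJ : MeasurableSet (Jset j) := measurableSet_Ioc
    have hint : Integrable (Set.indicator (Jset j) (fun _ => w * D)) := by
      rw [integrable_indicator_iff hmJ]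
      exact integrableOn_const (by simp [Jset])
    have hval : ∫ y, Set.indicator (Jset j) (fun _ => w * D) y = r * (w * D) := by
      rw [integral_indicator hmJ, setIntegral_const, smul_eq_mul, Measure.real,
        hvol]
    have key : |∫ y in Set.Ioo (0:ℝ) 1, P t x y * (w * Set.indicator (Jset j) (fun _ => (1:ℝ)) y)|
        ≤ r * (w * D) := by
      rw [← hval, ← Real.norm_eq_abs]
      refine le_trans (norm_integral_le_of_norm_le hint.integrableOn ?_)
        (setIntegral_le_integral hint (Filter.Eventually.of_forall fun y =>
          Set.indicator_nonneg (fun _ _ => by positivity) _))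
      filter_upwards [ae_restrict_mem measurableSet_Ioo] with y hy
      by_cases hyJ : y ∈ Jset j
      · rw [Set.indicator_of_mem hyJ, Set.indicator_of_mem hyJ, mul_one, Real.norm_eq_abs, abs_mul,
          abs_of_nonneg hw, mul_comm]
        apply mul_le_mul_of_nonneg_left _ hw
        have hyr : |Jhi j - y| ≤ r := by
          obtain ⟨h1, h2⟩ := hyJ
          rw [abs_of_nonneg (by linarith)]; linarith
        have htri : u ≤ |x - y| + |Jhi j - y| := by
          rw [hu]
          have := abs_sub_le x y (Jhi j)
          rwa [abs_sub_comm y] at this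
        set d := |x - y| with hd
        have hd1 : u / 2 ≤ d := by linarith
        have hd2 : r ≤ d := by linarith
        have hd0 : 0 < d := by linarith
        have hf := bb_factor (ν + 1/2) δ r x y t hδ hδ1 hδμ hr hx hy ht (bb_geom j y hyJ) hd2
        rw [← hd] at hf
        have hsq : (x - y) ^ 2 = d ^ 2 := (sq_abs _).symm
        calc _ ≤ _ := hP x hx y hy t ht
          _ = A * ((((x*y)/(t + x*y)) ^ (ν + 1/2) * min 1 ((1-x)*(1-y)/t)) * t ^ (-(1/2) : ℝ) *
              Real.exp (-d^2 / (c*t))) := by rw [hsq]; ring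
          _ ≤ A * ((6 * r * d / t) ^ δ * t ^ (-(1/2) : ℝ) * Real.exp (-d^2 / (c*t))) := by gcongr
          _ ≤ A * (6 * (1 + 2 * c ^ 2) * ((r / d) ^ δ / d)) := by
              gcongr A * ?_
              exact bb_far c δ r d t hc hδ hδ1 hr hd0 ht
          _ ≤ D := by rw [hD]; gcongr
      · rw [Set.indicator_of_notMem hyJ, Set.indicator_of_notMem hyJ]; simp
    have hfin : r * ((r / (u/2)) ^ δ / (u/2)) ≤ 9 * Z ^ (-(1 + δ)) := by
      have h0 : 0 < r / (u / 2) := by positivity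
      have e : r * ((r / (u/2)) ^ δ / (u/2)) = (r / (u/2)) ^ (1 + δ) := by
        rw [Real.rpow_add h0, Real.rpow_one]; ring
      have h1 : r / (u / 2) ≤ 3 / Z := by
        rw [div_le_div_iff₀ (by positivity) hZ0, hZ]
        have : r * (1 + u / r) = r + u := by field_simp
        rw [this]; linarith
      rw [e]
      calc _ ≤ (3 / Z) ^ (1 + δ) := Real.rpow_le_rpow h0.le h1 (by linarith)
        _ = 3 ^ (1 + δ) * Z ^ (-(1 + δ)) := by
            rw [Real.div_rpow (by norm_num) hZ0.le, Real.rpow_neg hZ0.le]; rfl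
        _ ≤ _ := by gcongr
    calc _ ≤ r * (w * D) := key
      _ = (w * A * (6 * (1 + 2 * c ^ 2))) * (r * ((r / (u/2)) ^ δ / (u/2))) := by rw [hD]; ring
      _ ≤ (w * A * (6 * (1 + 2 * c ^ 2) + √(Real.pi * c))) * (9 * Z ^ (-(1 + δ))) := by
          gcongr
          have : 0 ≤ √(Real.pi * c) := by positivity
          linarith
      _ = _ := by ring

/-- Uniform `L^p` bound for the radial maximal function of
type (b) atoms `a = |𝒥_j|^{-1/p} χ_{𝒥_j}` under the Gaussian-type bound for the
heat kernel of the Fourier–Bessel operator on `((0,1),dx)`, `ν > -1/2`,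
`δ = min{1, ν+1/2}`, `p ∈ (1/(1+δ), 1]`. -/
theorem bessel_dx_typeB_atom_maximal (ν p A c : ℝ) (hν : -(1/2 : ℝ) < ν)
    (hp : p ∈ Set.Ioc (1/(1 + min 1 (ν + 1/2))) 1) (hA : 0 < A) (hc : 0 < c) :
    ∃ C : ℝ, 0 < C ∧
    ∀ P : ℝ → ℝ → ℝ → ℝ,
      (∀ t : ℝ, 0 < t → Measurable (fun q : ℝ × ℝ => P t q.1 q.2)) →
      (∀ x ∈ Set.Ioo (0:ℝ) 1, ∀ y ∈ Set.Ioo (0:ℝ) 1, ∀ t : ℝ, 0 < t →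
        |P t x y| ≤ A * ((x*y)/(t + x*y)) ^ (ν + 1/2) * t ^ (-(1/2) : ℝ) *
          min 1 ((1-x)*(1-y)/t) * Real.exp (-(x-y)^2 / (c*t))) →
      ∀ j : ℤ, j ≠ 0 →
        ∫ x in Set.Ioo (0:ℝ) 1,
          (⨆ (t : ℝ) (_ : 0 < t),
            |∫ y in Set.Ioo (0:ℝ) 1,
              P t x y * ((volume (Jset j)).toReal ^ (-(1/p)) *
                Set.indicator (Jset j) (fun _ => (1:ℝ)) y)|) ^ p ≤ C := by
  obtain ⟨hp1, hp2⟩ := hp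
  set δ := min 1 (ν + 1/2) with hδdef
  have hδ : 0 < δ := lt_min one_pos (by linarith)
  have hδ1 : δ ≤ 1 := min_le_left _ _
  have hδμ : δ ≤ ν + 1/2 := min_le_right _ _
  have hp0 : 0 < p := lt_trans (by positivity) hp1
  have hq : 1 < (1 + δ) * p := by
    rw [div_lt_iff₀ (by positivity)] at hp1; linarith
  set B := 9 * A * (6 * (1 + 2 * c ^ 2) + √(Real.pi * c)) with hB
  have hB0 : 0 < B := by positivity
  have hI : Integrable (fun s : ℝ => (1 + ‖s‖) ^ (-((1 + δ) * p))) :=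
    integrable_one_add_norm (by simpa using hq)
  set S := ∫ s : ℝ, (1 + ‖s‖) ^ (-((1 + δ) * p)) with hS
  have hS0 : 0 ≤ S := integral_nonneg fun s => by positivity
  refine ⟨B ^ p * S + 1, by positivity, ?_⟩
  intro P _ hP j _
  obtain ⟨hvol, hr⟩ := bb_vol j
  rw [hvol]
  set r := Jhi j - Jlo j with hrdef
  set w := r ^ (-(1/p)) with hwdef
  have hw : 0 ≤ w := by positivity
  have hG : Integrable (fun x : ℝ => B ^ p * r⁻¹ * (1 + ‖(x - Jhi j) / r‖) ^ (-((1 + δ) * p))) :=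
    ((hI.comp_div hr.ne').comp_sub_right (Jhi j)).const_mul _
  have hGv : ∫ x : ℝ, B ^ p * r⁻¹ * (1 + ‖(x - Jhi j) / r‖) ^ (-((1 + δ) * p)) = B ^ p * S := by
    rw [integral_const_mul,
      integral_sub_right_eq_self (fun x => (1 + ‖x / r‖) ^ (-((1 + δ) * p))) (Jhi j),
      Measure.integral_comp_div (fun x => (1 + ‖x‖) ^ (-((1 + δ) * p))) r, ← hS, abs_of_pos hr,
      smul_eq_mul]
    field_simp
  have hnn : ∀ x, 0 ≤ ⨆ (t : ℝ) (_ : 0 < t),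
            |∫ y in Set.Ioo (0:ℝ) 1,
              P t x y * (w * Set.indicator (Jset j) (fun _ => (1:ℝ)) y)| := fun x =>
    Real.iSup_nonneg fun t => Real.iSup_nonneg fun _ => abs_nonneg _
  have main : ∫ x in Set.Ioo (0:ℝ) 1,
          (⨆ (t : ℝ) (_ : 0 < t),
            |∫ y in Set.Ioo (0:ℝ) 1,
              P t x y * (w * Set.indicator (Jset j) (fun _ => (1:ℝ)) y)|) ^ p ≤ B ^ p * S := by
    rw [← hGv]
    refine le_trans (integral_mono_of_nonneg ?_ hG.integrableOn ?_)
      (setIntegral_le_integral hG (Filter.Eventually.of_forall fun y => by positivity))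
    · exact Filter.Eventually.of_forall fun x => Real.rpow_nonneg (hnn x) _
    · filter_upwards [ae_restrict_mem measurableSet_Ioo] with x hx
      have hle : (⨆ (t : ℝ) (_ : 0 < t),
            |∫ y in Set.Ioo (0:ℝ) 1,
              P t x y * (w * Set.indicator (Jset j) (fun _ => (1:ℝ)) y)|) ≤
          B * w * (1 + |(x - Jhi j) / r|) ^ (-(1 + δ)) := by
        have h0 : 0 ≤ B * w * (1 + |(x - Jhi j) / r|) ^ (-(1 + δ)) := by positivity
        refine Real.iSup_le (fun t => Real.iSup_le (fun ht => ?_) h0) h0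
        exact bb_max ν A c δ w hν hA hc hδ hδ1 hδμ hw P hP j x hx t ht
      have hwp : w ^ p = r⁻¹ := by
        rw [hwdef, ← Real.rpow_mul hr.le, ← Real.rpow_neg_one]
        congr 1; field_simp
      calc _ ≤ (B * w * (1 + |(x - Jhi j) / r|) ^ (-(1 + δ))) ^ p :=
            Real.rpow_le_rpow (hnn x) hle hp0.le
        _ = _ := by
            rw [Real.mul_rpow (by positivity) (by positivity), Real.mul_rpow hB0.le hw, hwp,
              ← Real.rpow_mul (by positivity), Real.norm_eq_abs, neg_mul]
  linarith
end

section
/- Let ν > −1/2, set δ = min{1, ν+1/2}, and let p ∈ (1/(1+δ), 1]. Let j ∈ ℤ∖{0} and let I = (x_I − r_I, x_I + r_I) be an interval with I ⊂ 𝒥_j^*. Let a : (0,1) → ℝ be measurable with supp a ⊂ I, ‖a‖_∞ ≤ |I|^{−1/p}, and ∫_I a(y) dy = 0. Let P : (0,∞)×(0,1)×(0,1) → ℝ be measurable and suppose there are constants A, c > 0 such that: (K1) |P_t(x,y)| ≤ A t^{−1/2} e^{−(x−y)²/(ct)} for all x, y ∈ (0,1), t > 0; and (K2) |P_t(x,y)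 − P_t(x,x_I)| ≤ A ( |y−x_I| t^{−1} + ((xy)/(t+xy))^{ν+1/2} |y−x_I| y^{−1} t^{−1/2} ) e^{−(x−x_I)²/(ct)} for all t > 0, all y ∈ I, and all x ∈ (0,1) with |x − x_I| ≥ 2 r_I. Then there exists a constant C depending only on A, c, ν, p (and not on j, I, a) such that ∫₀¹ ( sup_{t>0} |∫₀¹ P_t(x,y) a(y) dy| )^p dx ≤ C. -/
open MeasureTheory

/-- Centre of `𝒥_j`. -/
noncomputable def Jcen (j : ℤ) : ℝ := (Jlo j + Jhi j) / 2

/-- Half-length of `𝒥_j`. -/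
noncomputable def Jrad (j : ℤ) : ℝ := (Jhi j - Jlo j) / 2

/-- `𝒥_j^*`: the interval with the same centre as `𝒥_j` and one tenth of its length. -/
noncomputable def Jstar (j : ℤ) : Set ℝ :=
  Set.Ioo (Jcen j - Jrad j / 10) (Jcen j + Jrad j / 10)


lemma aux_pow_exp (s u : ℝ) (hs : 0 < s) (hu : 0 ≤ u) : u ^ s * Real.exp (-u) ≤ s ^ s := by
  have h1 : u / s ≤ Real.exp (u / s) := by linarith [Real.add_one_le_exp (u / s)]
  have h2 : (u / s) ^ s ≤ Real.exp (u / s) ^ s := Real.rpow_le_rpow (by positivity) h1 hs.le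
  rw [← Real.exp_mul, div_mul_cancel₀ _ hs.ne', Real.div_rpow hu hs.le,
    div_le_iff₀ (by positivity)] at h2
  calc u ^ s * Real.exp (-u) ≤ (Real.exp u * s ^ s) * Real.exp (-u) := by gcongr
    _ = s ^ s * (Real.exp u * Real.exp (-u)) := by ring
    _ = s ^ s := by rw [← Real.exp_add]; simp

lemma aux_t (c s t D : ℝ) (hc : 0 < c) (hs : 0 < s) (ht : 0 < t) (hD : 0 < D) :
    t ^ (-s) * Real.exp (-D ^ 2 / (c * t)) ≤ (c * s) ^ s * D ^ (-(2 * s)) := by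
  have h := aux_pow_exp s (D ^ 2 / (c * t)) hs (by positivity)
  have e : (D ^ 2 / (c * t)) ^ s = D ^ (2 * s) * (c ^ s)⁻¹ * t ^ (-s) := by
    rw [Real.div_rpow (by positivity) (by positivity), Real.mul_rpow hc.le ht.le,
      Real.rpow_neg ht.le, Real.rpow_mul hD.le, Real.rpow_two]
    field_simp
  rw [e] at h
  rw [Real.mul_rpow hc.le hs.le, Real.rpow_neg hD.le, neg_div]
  have p1 : 0 < D ^ (2 * s) := by positivity
  have p2 : 0 < c ^ s := by positivity
  have : t ^ (-s) * Real.exp (-(D ^ 2 / (c * t))) =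
      (D ^ (2 * s) * (c ^ s)⁻¹ * t ^ (-s) * Real.exp (-(D ^ 2 / (c * t)))) *
        (c ^ s * (D ^ (2 * s))⁻¹) := by
    field_simp
  rw [this]
  calc _ ≤ s ^ s * (c ^ s * (D ^ (2 * s))⁻¹) := by gcongr
    _ = _ := by ring

noncomputable def K0 (c d : ℝ) : ℝ :=
  c + (c * (1/2)) ^ (1/2 : ℝ) + 3 ^ d * (c * (1/2 + d)) ^ (1/2 + d)

lemma aux_key (c d b t r y x D : ℝ) (hc : 0 < c) (hd : 0 < d) (hd1 : d ≤ 1) (hdb : d ≤ b)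
    (ht : 0 < t) (hr : 0 < r) (hry : r ≤ y) (hrD : r ≤ D) (hx : 0 < x) (hxD : x ≤ y + r + D) :
    r * (t⁻¹ + ((x*y)/(t + x*y)) ^ b * y⁻¹ * t ^ (-(1/2) : ℝ)) * Real.exp (-D ^ 2 / (c * t))
      ≤ K0 c d * ((r / D) ^ d / D) := by
  have hy : 0 < y := by linarith
  have hD : 0 < D := by linarith
  have hsmall : ∀ z : ℝ, r ≤ z → r / z ≤ (r / z) ^ d := by
    intro z hz
    have hz0 : 0 < z := by linarith
    have := Real.rpow_le_rpow_of_exponent_ge (x := r / z) (by positivity)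
      ((div_le_one hz0).2 hz) hd1
    simpa using this
  set E := Real.exp (-D ^ 2 / (c * t)) with hE
  have hE0 : 0 < E := Real.exp_pos _
  have T1 : r * t⁻¹ * E ≤ c * ((r / D) ^ d / D) := by
    have h := aux_t c 1 t D hc one_pos ht hD
    rw [Real.rpow_neg_one, mul_one, mul_one, Real.rpow_one, Real.rpow_neg hD.le, Real.rpow_two] at h
    calc r * t⁻¹ * E = r * (t⁻¹ * E) := by ring
      _ ≤ r * (c * (D ^ 2)⁻¹) := by gcongr
      _ = c * ((r / D) / D) := by field_simp
      _ ≤ _ := by gcongr; exact hsmall D hrD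
  set R := (x*y)/(t + x*y) with hR
  have hR0 : 0 < R := by positivity
  have hR1 : R ≤ 1 := by
    rw [hR, div_le_one (by positivity)]; linarith
  have hRt : R ≤ x * y / t := by
    rw [hR]; gcongr; nlinarith [mul_pos hx hy]
  have p1 : 0 ≤ (c * (1/2)) ^ (1/2 : ℝ) := by positivity
  have p2 : 0 ≤ 3 ^ d * (c * (1/2 + d)) ^ (1/2 + d) := by positivity
  have q : 0 ≤ (r / D) ^ d / D := by positivity
  have T2 : r * (R ^ b * y⁻¹ * t ^ (-(1/2) : ℝ)) * E ≤
      ((c * (1/2)) ^ (1/2 : ℝ) + 3 ^ d * (c * (1/2 + d)) ^ (1/2 + d)) * ((r / D) ^ d / D) := by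
    rcases le_total D y with h | h
    · have hb : R ^ b ≤ 1 := Real.rpow_le_one hR0.le hR1 (by linarith)
      have g := aux_t c (1/2) t D hc (by norm_num) ht hD
      rw [show -(2 * (1/2 : ℝ)) = -1 by norm_num, Real.rpow_neg_one] at g
      calc r * (R ^ b * y⁻¹ * t ^ (-(1/2) : ℝ)) * E
          = R ^ b * ((r / y) * (t ^ (-(1/2) : ℝ) * E)) := by field_simp
        _ ≤ 1 * ((r / D) ^ d * ((c * (1/2)) ^ (1/2 : ℝ) * D⁻¹)) := by
            gcongr
            refine (hsmall y hry).trans ?_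
            gcongr
        _ = (c * (1/2)) ^ (1/2 : ℝ) * ((r / D) ^ d / D) := by field_simp
        _ ≤ _ := by gcongr; linarith
    · have hb : R ^ b ≤ (3 * D * y / t) ^ d := by
        refine (Real.rpow_le_rpow_of_exponent_ge hR0 hR1 hdb).trans ?_
        refine Real.rpow_le_rpow hR0.le (hRt.trans ?_) hd.le
        gcongr
        linarith
      have g := aux_t c (1/2 + d) t D hc (by positivity) ht hD
      rw [show -(1/2 + d) = -(1/2 : ℝ) + -d by ring, Real.rpow_add ht,
        show -(2 * (1/2 + d : ℝ)) = -1 + -d + -d by ring, Real.rpow_add hD, Real.rpow_add hD,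
        Real.rpow_neg_one] at g
      calc r * (R ^ b * y⁻¹ * t ^ (-(1/2) : ℝ)) * E
          = R ^ b * ((r / y) * (t ^ (-(1/2) : ℝ) * E)) := by field_simp
        _ ≤ (3 * D * y / t) ^ d * ((r / y) ^ d * (t ^ (-(1/2) : ℝ) * E)) := by
            gcongr
            exact hsmall y hry
        _ = (3 ^ d * D ^ d * r ^ d) * (t ^ (-(1/2) : ℝ) * t ^ (-d) * E) := by
            rw [Real.div_rpow (by positivity) ht.le, Real.mul_rpow (by positivity) hy.le,
              Real.mul_rpow (by positivity) hD.le, Real.div_rpow hr.le hy.le, Real.rpow_neg ht.le d]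
            have : 0 < y ^ d := by positivity
            field_simp
        _ ≤ (3 ^ d * D ^ d * r ^ d) * ((c * (1/2 + d)) ^ (1/2 + d) * (D⁻¹ * D ^ (-d) * D ^ (-d))) := by
            gcongr
        _ = (3 ^ d * (c * (1/2 + d)) ^ (1/2 + d)) * ((r / D) ^ d / D) := by
            rw [Real.div_rpow hr.le hD.le, Real.rpow_neg hD.le]
            have : 0 < D ^ d := by positivity
            field_simp
        _ ≤ _ := by gcongr; linarith
  have : K0 c d = c + ((c * (1/2)) ^ (1/2 : ℝ) + 3 ^ d * (c * (1/2 + d)) ^ (1/2 + d)) := by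
    unfold K0; ring
  rw [this]
  nlinarith [T1, T2]

lemma aux_near (A c M t x : ℝ) (hA : 0 < A) (hc : 0 < c) (hM : 0 ≤ M) (ht : 0 < t)
    (f a : ℝ → ℝ) (ha : ∀ y, |a y| ≤ M)
    (hf : ∀ y ∈ Set.Ioo (0:ℝ) 1, |f y| ≤ A * t ^ (-(1/2) : ℝ) * Real.exp (-(x-y)^2 / (c*t))) :
    |∫ y in Set.Ioo (0:ℝ) 1, f y * a y| ≤ M * (A * √(Real.pi * c)) := by
  have hb : 0 < 1 / (c * t) := by positivity
  have hi : Integrable (fun y : ℝ => A * t ^ (-(1/2) : ℝ) * M * Real.exp (-(1 / (c*t)) * (x - y)^2)) :=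
    ((integrable_exp_neg_mul_sq hb).comp_sub_left x).const_mul _
  have h1 : ‖∫ y in Set.Ioo (0:ℝ) 1, f y * a y‖ ≤
      ∫ y in Set.Ioo (0:ℝ) 1, A * t ^ (-(1/2) : ℝ) * M * Real.exp (-(1 / (c*t)) * (x - y)^2) := by
    refine norm_integral_le_of_norm_le hi.integrableOn ?_
    filter_upwards [ae_restrict_mem measurableSet_Ioo] with y hy
    rw [Real.norm_eq_abs, abs_mul]
    calc |f y| * |a y| ≤ (A * t ^ (-(1/2) : ℝ) * Real.exp (-(x-y)^2 / (c*t))) * M := by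
          gcongr
          · exact hf y hy
          · exact ha y
      _ = _ := by
          rw [show -(x-y)^2 / (c*t) = -(1 / (c*t)) * (x - y)^2 by ring]; ring
  rw [Real.norm_eq_abs] at h1
  refine h1.trans ((setIntegral_le_integral hi (Filter.Eventually.of_forall fun y => by
    simp only [Pi.zero_apply]; positivity)).trans ?_)
  rw [integral_const_mul, integral_sub_left_eq_self (fun z : ℝ => Real.exp (-(1 / (c*t)) * z^2)),
    integral_gaussian]
  rw [show Real.pi / (1 / (c * t)) = (Real.pi * c) * t by field_simp, Real.sqrt_mul (by positivity),
    Real.rpow_neg ht.le, ← Real.sqrt_eq_rpow]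
  apply le_of_eq
  have : 0 < √t := by positivity
  field_simp

lemma aux_far (xI r M Q : ℝ) (hr : 0 < r) (hI : Set.Ioo (xI - r) (xI + r) ⊆ Set.Ioo (0:ℝ) 1)
    (f a : ℝ → ℝ) (hf : Measurable f) (ham : Measurable a)
    (hsupp : Function.support a ⊆ Set.Ioo (xI - r) (xI + r)) (ha : ∀ y, |a y| ≤ M)
    (h0 : (∫ y in Set.Ioo (xI - r) (xI + r), a y) = 0) (v B : ℝ)
    (hfB : ∀ y ∈ Set.Ioo (xI - r) (xI + r), |f y| ≤ B)
    (hQ : ∀ y ∈ Set.Ioo (xI - r) (xI + r), |f y - v| ≤ Q) :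
    |∫ y in Set.Ioo (0:ℝ) 1, f y * a y| ≤ Q * M * (2 * r) := by
  have hxI : xI ∈ Set.Ioo (xI - r) (xI + r) := ⟨by linarith, by linarith⟩
  have hQ0 : 0 ≤ Q := (abs_nonneg _).trans (hQ _ hxI)
  have hB0 : 0 ≤ B := (abs_nonneg _).trans (hfB _ hxI)
  have e1 : ∫ y in Set.Ioo (0:ℝ) 1, f y * a y = ∫ y in Set.Ioo (xI - r) (xI + r), f y * a y := by
    refine setIntegral_eq_of_subset_of_forall_sdiff_eq_zero measurableSet_Ioo hI ?_
    intro y hy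
    have : a y = 0 := by
      by_contra h
      exact hy.2 (hsupp h)
    simp [this]
  have i1 : IntegrableOn a (Set.Ioo (xI - r) (xI + r)) :=
    Measure.integrableOn_of_bounded (M := M) (by simp) ham.aestronglyMeasurable
      (Filter.Eventually.of_forall ha)
  have i2 : IntegrableOn (fun y => f y * a y) (Set.Ioo (xI - r) (xI + r)) := by
    refine Measure.integrableOn_of_bounded (M := B * M) (by simp)
      (hf.mul ham).aestronglyMeasurable ?_
    filter_upwards [ae_restrict_mem measurableSet_Ioo] with y hy
    rw [Real.norm_eq_abs, abs_mul]
    exact mul_le_mul (hfB y hy) (ha y) (abs_nonneg _) hB0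
  have e2 : ∫ y in Set.Ioo (xI - r) (xI + r), f y * a y =
      ∫ y in Set.Ioo (xI - r) (xI + r), (f y - v) * a y := by
    have : ∀ y, (f y - v) * a y = f y * a y - v * a y := fun y => by ring
    simp_rw [this]
    rw [integral_sub i2 (i1.const_mul v), integral_const_mul, h0]
    simp
  rw [e1, e2, ← Real.norm_eq_abs]
  refine (norm_setIntegral_le_of_norm_le_const (C := Q * M) (by simp) ?_).trans ?_
  · intro y hy
    rw [Real.norm_eq_abs, abs_mul]
    exact mul_le_mul (hQ y hy) (ha y) (abs_nonneg _) hQ0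
  · apply le_of_eq
    rw [Real.volume_real_Ioo_of_le (by linarith)]
    ring

lemma aux_J (j : ℤ) (hj : j ≠ 0) : 0 ≤ Jlo j ∧ Jlo j < Jhi j ∧ Jhi j ≤ 1 := by
  unfold Jlo Jhi
  split_ifs with h
  · have h1 : (2:ℝ) ^ (-j) ≤ 1 := zpow_le_one_of_nonpos₀ (by norm_num) (by omega)
    have h2 : (2:ℝ) ^ (-j-1) = 2 ^ (-j) / 2 := by rw [zpow_sub_one₀ (by norm_num)]; ring
    have h3 : (0:ℝ) < 2 ^ (-j) := by positivity
    rw [h2]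
    refine ⟨?_, ?_, ?_⟩ <;> linarith
  · have h1 : (2:ℝ) ^ j ≤ 1 := zpow_le_one_of_nonpos₀ (by norm_num) (by omega)
    have h2 : (2:ℝ) ^ (j-1) = 2 ^ j / 2 := by rw [zpow_sub_one₀ (by norm_num)]; ring
    have h3 : (0:ℝ) < 2 ^ j := by positivity
    rw [h2]
    refine ⟨?_, ?_, ?_⟩ <;> linarith

lemma aux_I (j : ℤ) (hj : j ≠ 0) (xI r : ℝ) (hr : 0 < r)
    (hI : Set.Ioo (xI - r) (xI + r) ⊆ Jstar j) :
    2 * r ≤ xI ∧ xI + r ≤ 1 := by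
  obtain ⟨h1, h2, h3⟩ := aux_J j hj
  unfold Jstar Jcen Jrad at hI
  rw [Set.Ioo_subset_Ioo_iff (by linarith)] at hI
  constructor <;> linarith [hI.1, hI.2]

/-- Uniform `L^p` bound for the radial maximal function of
type (a) atoms supported in `𝒥_j^*`, under the Gaussian bound (K1) and the
Hölder-type difference bound (K2) for the heat kernel of the Fourier–Bessel
operator on `((0,1),dx)`, `ν > -1/2`, `δ = min{1, ν+1/2}`, `p ∈ (1/(1+δ), 1]`. -/
theorem bessel_dx_typeA_atom_maximal (ν p A c : ℝ) (hν : -(1/2 : ℝ) < ν)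
    (hp : p ∈ Set.Ioc (1/(1 + min 1 (ν + 1/2))) 1) (hA : 0 < A) (hc : 0 < c) :
    ∃ C : ℝ, 0 < C ∧
    ∀ j : ℤ, j ≠ 0 →
    ∀ xI rI : ℝ, 0 < rI → Set.Ioo (xI - rI) (xI + rI) ⊆ Jstar j →
    ∀ a : ℝ → ℝ, Measurable a →
      Function.support a ⊆ Set.Ioo (xI - rI) (xI + rI) →
      (∀ y, |a y| ≤ (2*rI) ^ (-(1/p))) →
      (∫ y in Set.Ioo (xI - rI) (xI + rI), a y) = 0 →
    ∀ P : ℝ → ℝ → ℝ → ℝ,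
      (∀ t : ℝ, 0 < t → Measurable (fun q : ℝ × ℝ => P t q.1 q.2)) →
      (∀ x ∈ Set.Ioo (0:ℝ) 1, ∀ y ∈ Set.Ioo (0:ℝ) 1, ∀ t : ℝ, 0 < t →
        |P t x y| ≤ A * t ^ (-(1/2) : ℝ) * Real.exp (-(x-y)^2 / (c*t))) →
      (∀ t : ℝ, 0 < t → ∀ y ∈ Set.Ioo (xI - rI) (xI + rI), ∀ x ∈ Set.Ioo (0:ℝ) 1,
        2*rI ≤ |x - xI| →
        |P t x y - P t x xI| ≤
          A * (|y - xI| * t⁻¹ +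
              ((x*y)/(t + x*y)) ^ (ν + 1/2) * |y - xI| * y⁻¹ * t ^ (-(1/2) : ℝ)) *
            Real.exp (-(x - xI)^2 / (c*t))) →
      ∫ x in Set.Ioo (0:ℝ) 1,
        (⨆ (t : ℝ) (_ : 0 < t),
          |∫ y in Set.Ioo (0:ℝ) 1, P t x y * a y|) ^ p ≤ C := by
  obtain ⟨hp1, hp2⟩ := hp
  set d := min 1 (ν + 1/2) with hd
  have hd0 : 0 < d := lt_min one_pos (by linarith)
  have hd1 : d ≤ 1 := min_le_left _ _
  have hdb : d ≤ ν + 1/2 := min_le_right _ _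
  have hp0 : 0 < p := lt_trans (by positivity) hp1
  have hs : 1 < (1 + d) * p := by
    rw [div_lt_iff₀ (by positivity)] at hp1
    linarith
  have hK0 : 0 < K0 c d := by unfold K0; positivity
  set K : ℝ := 2 ^ (1 + d) * (A * √(Real.pi * c)) + 2 * A * K0 c d with hK
  have hKpos : 0 < K := by positivity
  set φ : ℝ → ℝ := fun u => (1 + ‖u‖) ^ (-((1 + d) * p)) with hφ
  have hφi : Integrable φ := integrable_one_add_norm (by simpa using hs)
  have hφ0 : ∀ u, 0 ≤ φ u := fun u => by simp only [hφ]; positivity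
  have hφI : 0 ≤ ∫ u, φ u := integral_nonneg hφ0
  refine ⟨K ^ p * (∫ u, φ u) + 1, by positivity, ?_⟩
  intro j hj xI r hr hI a ham hsupp ha h0 P hPm hK1 hK2
  obtain ⟨hxr, hx1⟩ := aux_I j hj xI r hr hI
  have hI01 : Set.Ioo (xI - r) (xI + r) ⊆ Set.Ioo (0:ℝ) 1 := by
    intro y hy
    exact ⟨by linarith [hy.1], by linarith [hy.2]⟩
  set M : ℝ := (2 * r) ^ (-(1/p)) with hM
  have hM0 : 0 < M := by positivity
  have hpt : ∀ x ∈ Set.Ioo (0:ℝ) 1, ∀ t : ℝ, 0 < t →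
      |∫ y in Set.Ioo (0:ℝ) 1, P t x y * a y| ≤
        M * K * (1 + ‖(x - xI) / (2 * r)‖) ^ (-(1 + d)) := by
    intro x hx t ht
    have hu : ‖(x - xI) / (2 * r)‖ = |x - xI| / (2 * r) := by
      rw [Real.norm_eq_abs, abs_div, abs_of_pos (by positivity : (0:ℝ) < 2 * r)]
    rw [hu]
    have hq : 0 < 1 + |x - xI| / (2 * r) := by positivity
    rcases lt_or_ge |x - xI| (2 * r) with h | h
    · refine (aux_near A c M t x hA hc hM0.le ht (P t x) a ha
        (fun y hy => hK1 x hx y hy t ht)).trans ?_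
      rw [mul_assoc]
      refine mul_le_mul_of_nonneg_left ?_ hM0.le
      have h2 : 1 + |x - xI| / (2 * r) ≤ 2 := by
        have := (div_le_one (by positivity : (0:ℝ) < 2 * r)).2 h.le
        linarith
      have h3 : (2:ℝ) ^ (-(1 + d)) ≤ (1 + |x - xI| / (2 * r)) ^ (-(1 + d)) :=
        Real.rpow_le_rpow_of_nonpos hq h2 (by linarith)
      calc A * √(Real.pi * c) = (2 ^ (1 + d) * (A * √(Real.pi * c))) * 2 ^ (-(1 + d)) := by
            rw [Real.rpow_neg (by norm_num)]
            field_simp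
        _ ≤ K * 2 ^ (-(1 + d)) := by
            gcongr
            rw [hK]
            have : 0 < 2 * A * K0 c d := by positivity
            linarith
        _ ≤ _ := by gcongr
    · have hD : 0 < |x - xI| := by linarith
      have hxle : x ≤ xI + |x - xI| := by linarith [le_abs_self (x - xI)]
      have hfar := aux_far xI r M (A * (K0 c d * ((r / |x - xI|) ^ d / |x - xI|))) hr hI01
        (P t x) a ((hPm t ht).comp measurable_prodMk_left) ham hsupp ha h0 (P t x xI)
        (A * t ^ (-(1/2) : ℝ)) ?_ ?_
      · refine hfar.trans ?_
        have e : A * (K0 c d * ((r / |x - xI|) ^ d / |x - xI|)) * M * (2 * r) =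
            M * ((2 * A * K0 c d) * (r / |x - xI|) ^ (1 + d)) := by
          rw [Real.rpow_add (by positivity), Real.rpow_one]
          field_simp
        rw [e, mul_assoc M K]
        have h4 : r / |x - xI| ≤ (1 + |x - xI| / (2 * r))⁻¹ := by
          rw [← inv_div]
          apply inv_anti₀ hq
          have : |x - xI| / r = |x - xI| / (2 * r) + |x - xI| / (2 * r) := by field_simp; norm_num
          rw [this]
          have := (one_le_div (by positivity : (0:ℝ) < 2 * r)).2 h
          linarith
        have h5 : 2 * A * K0 c d ≤ K := by
          rw [hK]
          have : 0 < 2 ^ (1 + d) * (A * √(Real.pi * c)) := by positivity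
          linarith
        rw [Real.rpow_neg hq.le, ← Real.inv_rpow hq.le]
        gcongr
      · intro y hy
        refine (hK1 x hx y (hI01 hy) t ht).trans ?_
        have : Real.exp (-(x-y)^2 / (c*t)) ≤ 1 := by
          rw [Real.exp_le_one_iff, neg_div]
          have : 0 ≤ (x-y)^2 / (c*t) := by positivity
          linarith
        exact mul_le_of_le_one_right (by positivity) this
      · intro y hy
        refine (hK2 t ht y hy x hx h).trans ?_
        have hy0 : 0 < y := (hI01 hy).1
        have hx0 : 0 < x := hx.1
        have hyr : |y - xI| ≤ r := by
          rw [abs_le]; constructor <;> linarith [hy.1, hy.2]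
        have key := aux_key c d (ν + 1/2) t r y x |x - xI| hc hd0 hd1 hdb ht hr
          (by linarith [hy.1]) (by linarith) hx0 (by linarith [hy.1])
        rw [sq_abs] at key
        refine le_trans ?_ (mul_le_mul_of_nonneg_left key hA.le)
        calc _ = A * (|y - xI| * (t⁻¹ + ((x*y)/(t + x*y)) ^ (ν + 1/2) * y⁻¹ * t ^ (-(1/2) : ℝ)) *
                Real.exp (-(x - xI)^2 / (c*t))) := by ring
          _ ≤ _ := by gcongr
  have hψi : Integrable (fun x => (2 * r)⁻¹ * K ^ p * φ ((x - xI) / (2 * r))) :=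
    ((hφi.comp_div (by positivity : (2 * r) ≠ 0)).comp_sub_right xI).const_mul _
  have hle : ∫ x in Set.Ioo (0:ℝ) 1,
        (⨆ (t : ℝ) (_ : 0 < t), |∫ y in Set.Ioo (0:ℝ) 1, P t x y * a y|) ^ p ≤
      ∫ x in Set.Ioo (0:ℝ) 1, (2 * r)⁻¹ * K ^ p * φ ((x - xI) / (2 * r)) := by
    have hnn : ∀ x : ℝ, 0 ≤ ⨆ (t : ℝ) (_ : 0 < t), |∫ y in Set.Ioo (0:ℝ) 1, P t x y * a y| :=
      fun x => Real.iSup_nonneg fun t => Real.iSup_nonneg fun _ => abs_nonneg _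
    refine integral_mono_of_nonneg (Filter.Eventually.of_forall fun x =>
      Real.rpow_nonneg (hnn x) p) hψi.integrableOn ?_
    filter_upwards [ae_restrict_mem measurableSet_Ioo] with x hx
    have hB : 0 ≤ M * K * (1 + ‖(x - xI) / (2 * r)‖) ^ (-(1 + d)) := by positivity
    have hsup : (⨆ (t : ℝ) (_ : 0 < t), |∫ y in Set.Ioo (0:ℝ) 1, P t x y * a y|) ≤
        M * K * (1 + ‖(x - xI) / (2 * r)‖) ^ (-(1 + d)) :=
      Real.iSup_le (fun t => Real.iSup_le (fun ht => hpt x hx t ht) hB) hB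
    refine (Real.rpow_le_rpow (hnn x) hsup hp0.le).trans (le_of_eq ?_)
    rw [Real.mul_rpow (by positivity) (by positivity), Real.mul_rpow hM0.le hKpos.le, hM,
      ← Real.rpow_mul (by positivity), ← Real.rpow_mul (by positivity)]
    have e1 : -(1/p) * p = -1 := by field_simp
    rw [e1, Real.rpow_neg_one, neg_mul]
  refine hle.trans ((setIntegral_le_integral hψi (Filter.Eventually.of_forall fun x => by
    have := hφ0 ((x - xI) / (2 * r))
    simp only [Pi.zero_apply]; positivity)).trans ?_)
  rw [integral_const_mul, integral_sub_right_eq_self (fun z => φ (z / (2 * r))) xI,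
    Measure.integral_comp_div, abs_of_pos (by positivity : (0:ℝ) < 2 * r), smul_eq_mul]
  have : (2 * r)⁻¹ * K ^ p * (2 * r * ∫ u, φ u) = K ^ p * ∫ u, φ u := by field_simp
  rw [this]
  linarith
end

section
/- Let ν > −1, λ > 0, and let μ_ν be the measure on (0,1) with density x^{2ν+1} with respect to Lebesgue measure. Let P : (0,∞)×(0,1)×(0,1) → [0,∞) be measurable and suppose there are constants A, c > 0 such that for all x, y ∈ (0,1) and t > 0: P_t(x,y) ≤ A (1+t)^{ν+2} (t+xy)^{−(ν+1/2)} t^{−1/2} min{1, (1−x)(1−y)/t} e^{−(x−y)²/(ct) − λt}, and moreover ∫₀¹ P_t(x,y) dμ_ν(y) ≤ A for all x ∈ (0,1) and t > 0. For j ∈ ℕ let a = μ_ν(ℐ_j)^{−1} χ_{ℐ_j}. Then there exists a constant C depending only on A, c, ν, λ (and not on j) such that ∫₀¹ sup_{t>0} |∫₀¹ P_t(x,y) a(y) dμ_ν(y)| dμ_ν(x) ≤ C. -/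
open MeasureTheory

/-- `ℐ_j = (1-2^{-j}, 1-2^{-j-1}]` for `j ∈ ℕ`. -/
noncomputable def Iset (j : ℕ) : Set ℝ :=
  Set.Ioc (1 - (2:ℝ)^(-(j:ℤ))) (1 - (2:ℝ)^(-(j:ℤ)-1))

lemma bh_exp (q u : ℝ) (hq : 0 < q) (hu : 0 < u) : u ^ q * Real.exp (-u) ≤ q ^ q := by
  have h1 : u ≤ q * Real.exp (u / q) := by
    have := Real.add_one_le_exp (u / q)
    have h2 : u / q ≤ Real.exp (u / q) := by linarith
    rw [div_le_iff₀ hq] at h2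
    linarith
  have h3 : u ^ q ≤ (q * Real.exp (u / q)) ^ q := Real.rpow_le_rpow hu.le h1 hq.le
  rw [Real.mul_rpow hq.le (Real.exp_pos _).le, ← Real.exp_mul, div_mul_cancel₀ _ hq.ne'] at h3
  calc u ^ q * Real.exp (-u) ≤ (q ^ q * Real.exp u) * Real.exp (-u) := by gcongr
    _ = q ^ q := by rw [mul_assoc, ← Real.exp_add]; simp

lemma bh_rpow (s M p : ℝ) (hs : 0 < s) (h1 : s ≤ M) (h2 : s⁻¹ ≤ M) : s ^ p ≤ M ^ |p| := by
  rcases le_total 0 p with hp | hp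
  · rw [abs_of_nonneg hp]; exact Real.rpow_le_rpow hs.le h1 hp
  · rw [abs_of_nonpos hp]
    have : s ^ p = (s⁻¹) ^ (-p) := by
      rw [Real.inv_rpow hs.le, Real.rpow_neg hs.le, inv_inv]
    rw [this]
    exact Real.rpow_le_rpow (by positivity) h2 (by linarith)

lemma bh_core (lam c N q : ℝ) (hlam : 0 < lam) (hc : 0 < c) (hN : 0 < N) (hq : 0 < q) :
    ∃ K : ℝ, 0 < K ∧ ∀ t d : ℝ, 0 < t → 0 < d →
      (1+t) ^ N * t ^ (-q) * Real.exp (-d^2 / (4*c*t) - lam * t) ≤ K * (d^2) ^ (-q) := by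
  refine ⟨(N ^ N * lam ^ (-N) * Real.exp lam) * (q ^ q * (4*c) ^ q), by positivity, ?_⟩
  intro t d ht hd
  have e1 := bh_exp N (lam * (1+t)) hN (by positivity)
  have e2 := bh_exp q (d^2 / (4*c*t)) hq (by positivity)
  have f1 : (1+t) ^ N * Real.exp (-(lam*t)) ≤ N ^ N * lam ^ (-N) * Real.exp lam := by
    have : (1+t) ^ N * Real.exp (-(lam*t)) =
        ((lam * (1+t)) ^ N * Real.exp (-(lam * (1+t)))) * (lam ^ (-N) * Real.exp lam) := by
      rw [Real.mul_rpow hlam.le (by positivity), Real.rpow_neg hlam.le]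
      have : Real.exp (-(lam*t)) = Real.exp (-(lam * (1+t))) * Real.exp lam := by
        rw [← Real.exp_add]; congr 1; ring
      rw [this]
      have : lam ^ N ≠ 0 := by positivity
      field_simp
    rw [this, mul_assoc (N^N)]
    gcongr
  have f2 : t ^ (-q) * Real.exp (-(d^2 / (4*c*t))) ≤ q ^ q * (4*c) ^ q * (d^2) ^ (-q) := by
    have : t ^ (-q) * Real.exp (-(d^2 / (4*c*t))) =
        ((d^2 / (4*c*t)) ^ q * Real.exp (-(d^2 / (4*c*t)))) * ((4*c) ^ q * (d^2) ^ (-q)) := by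
      rw [Real.div_rpow (by positivity) (by positivity), Real.mul_rpow (by positivity) ht.le,
        Real.rpow_neg ht.le, Real.rpow_neg (by positivity)]
      have h1 : (4*c) ^ q ≠ 0 := by positivity
      have h2 : (d^2) ^ q ≠ 0 := by positivity
      have h3 : t ^ q ≠ 0 := by positivity
      field_simp
    rw [this, mul_assoc (q^q)]
    gcongr
  have : Real.exp (-d^2 / (4*c*t) - lam * t) =
      Real.exp (-(d^2 / (4*c*t))) * Real.exp (-(lam*t)) := by
    rw [← Real.exp_add]; congr 1; ring
  rw [this]
  calc _ = ((1+t) ^ N * Real.exp (-(lam*t))) * (t ^ (-q) * Real.exp (-(d^2 / (4*c*t)))) := by ring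
    _ ≤ (N ^ N * lam ^ (-N) * Real.exp lam) * (q ^ q * (4*c) ^ q * (d^2) ^ (-q)) := by gcongr
    _ = _ := by ring

lemma bh_far (ν lam A c : ℝ)
    (hν : -1 < ν) (hlam : 0 < lam) (hA : 0 < A) (hc : 0 < c) :
    ∃ K : ℝ, 0 < K ∧ ∀ x y t r : ℝ, 0 < x → x < 1 → 1/2 ≤ y → y < 1 → 0 < r → 1 - r ≤ y →
      x ≤ 1 - 2*r → 0 < t →
      A * (1+t) ^ (ν+2) * (t + x*y) ^ (-(ν+1/2)) * t ^ (-(1/2) : ℝ) *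
          min 1 ((1-x)*(1-y)/t) * Real.exp (-(x-y)^2 / (c*t) - lam * t) ≤ K * (r / (1-x)^2) := by
  set k := |-(ν+1/2)| with hk
  have hk0 : 0 ≤ k := abs_nonneg _
  obtain ⟨K1, hK1, H1⟩ := bh_core lam c (ν+2+k) (3/2) hlam hc (by linarith) (by norm_num)
  obtain ⟨K2, hK2, H2⟩ := bh_core lam c (ν+2+2*k) (3/2+k) hlam hc (by linarith) (by linarith)
  refine ⟨A * 8 ^ k * K1 + A * K2 * 4 ^ (3/2+k), by positivity, ?_⟩
  intro x y t r hx hx1 hy hy1 hr hry hxr ht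
  set d := 1 - x with hd
  have hd0 : 0 < d := by rw [hd]; linarith
  have hd1 : d ≤ 1 := by rw [hd]; linarith
  have hxy : x * y ≤ 1 := by nlinarith
  have hxy0 : 0 < x * y := by positivity
  have hmin : min 1 ((1-x)*(1-y)/t) ≤ d * r / t := by
    refine (min_le_right _ _).trans ?_
    gcongr
    linarith
  have hmin0 : 0 ≤ min 1 ((1-x)*(1-y)/t) := by
    apply le_min zero_le_one
    have : 0 ≤ 1 - y := by linarith
    positivity
  have hexp : Real.exp (-(x-y)^2 / (c*t) - lam * t) ≤ Real.exp (-d^2 / (4*c*t) - lam * t) := by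
    apply Real.exp_le_exp.mpr
    have h1 : d^2/4 ≤ (x-y)^2 := by
      have : d / 2 ≤ y - x := by rw [hd]; linarith
      nlinarith
    have h2 : d^2/4 / (c*t) ≤ (x-y)^2 / (c*t) := by gcongr
    have h3 : d^2/4 / (c*t) = d^2 / (4*c*t) := by field_simp
    rw [neg_div, neg_div]
    linarith
  have ht32 : t ^ (-(1/2) : ℝ) * (d * r / t) = d * r * t ^ (-(3/2) : ℝ) := by
    have : t ^ (-(3/2) : ℝ) = t ^ (-(1/2) : ℝ) * t⁻¹ := by
      rw [← Real.rpow_neg_one t, ← Real.rpow_add ht]; norm_num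
    rw [this]; field_simp
  have main : ∀ T : ℝ, (t + x*y) ^ (-(ν+1/2)) ≤ T →
      A * (1+t) ^ (ν+2) * (t + x*y) ^ (-(ν+1/2)) * t ^ (-(1/2) : ℝ) *
          min 1 ((1-x)*(1-y)/t) * Real.exp (-(x-y)^2 / (c*t) - lam * t) ≤
      A * d * r * ((1+t) ^ (ν+2) * T * t ^ (-(3/2) : ℝ) * Real.exp (-d^2 / (4*c*t) - lam * t)) := by
    intro T hT
    have hT0 : 0 ≤ T := le_trans (by positivity) hT
    calc _ ≤ A * (1+t) ^ (ν+2) * T * t ^ (-(1/2) : ℝ) *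
          (d * r / t) * Real.exp (-d^2 / (4*c*t) - lam * t) := by gcongr
      _ = A * (1+t) ^ (ν+2) * T * (t ^ (-(1/2) : ℝ) *
          (d * r / t)) * Real.exp (-d^2 / (4*c*t) - lam * t) := by ring
      _ = _ := by rw [ht32]; ring
  have P1 : 0 ≤ A * 8 ^ k * K1 * (r / d^2) := by positivity
  have P2 : 0 ≤ A * K2 * 4 ^ (3/2+k) * (r / d^2) := by positivity
  have ht1 : 0 < 1 + t := by linarith
  rcases le_or_gt (1/4) x with hx4 | hx4
  · have hs := bh_rpow (t + x*y) (8 * (1+t)) (-(ν+1/2)) (by positivity) (by linarith) (by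
      have : (1/8 : ℝ) ≤ t + x*y := by nlinarith
      calc (t+x*y)⁻¹ ≤ (1/8:ℝ)⁻¹ := by gcongr
        _ ≤ _ := by norm_num; linarith)
    rw [← hk, Real.mul_rpow (by norm_num) ht1.le] at hs
    refine (main _ hs).trans ?_
    have h := H1 t d ht hd0
    rw [Real.rpow_add ht1] at h
    have hd3 : d * (d^2) ^ (-(3/2) : ℝ) = 1 / d^2 := by
      rw [← Real.rpow_natCast d 2, ← Real.rpow_mul hd0.le]
      have : d ^ (((2:ℕ):ℝ) * -(3/2)) = (d^3)⁻¹ := by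
        rw [← Real.rpow_natCast d 3, ← Real.rpow_neg hd0.le]; norm_num
      rw [this, Real.rpow_natCast]; field_simp
    calc _ = A * 8 ^ k * d * r * ((1+t) ^ (ν+2) * (1+t)^k * t ^ (-(3/2) : ℝ) * Real.exp (-d^2 / (4*c*t) - lam * t)) := by ring
      _ ≤ A * 8 ^ k * d * r * (K1 * (d^2) ^ (-(3/2) : ℝ)) := by gcongr
      _ = A * 8 ^ k * r * K1 * (d * (d^2) ^ (-(3/2) : ℝ)) := by ring
      _ = A * 8 ^ k * K1 * (r / d^2) := by rw [hd3]; ring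
      _ ≤ _ := by linarith
  · have hs := bh_rpow (t + x*y) ((1+t)^2 * t⁻¹) (-(ν+1/2)) (by positivity) (by
      have : (1+t)^2 * t⁻¹ = (1+t) + (1+t)/t := by field_simp; ring
      rw [this]; have : 0 < (1+t)/t := by positivity
      linarith) (by
      calc (t+x*y)⁻¹ ≤ t⁻¹ := by gcongr; linarith
        _ = 1 * t⁻¹ := by ring
        _ ≤ _ := by gcongr; nlinarith)
    rw [← hk, Real.mul_rpow (by positivity) (by positivity), Real.inv_rpow ht.le,
      ← Real.rpow_neg ht.le, ← Real.rpow_natCast, ← Real.rpow_mul ht1.le] at hs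
    refine (main _ hs).trans ?_
    have h := H2 t d ht hd0
    rw [Real.rpow_add ht1, show -(3/2+k) = -k + -(3/2) by ring, Real.rpow_add ht,
      show -k + -(3/2) = -(3/2+k) by ring] at h
    have hd4 : (d^2) ^ (-(3/2+k)) ≤ 4 ^ (3/2+k) := by
      rw [Real.rpow_neg (by positivity), ← Real.inv_rpow (by positivity)]
      gcongr
      have : (1/4:ℝ) ≤ d^2 := by rw [hd]; nlinarith
      calc (d^2)⁻¹ ≤ (1/4:ℝ)⁻¹ := by gcongr
        _ = 4 := by norm_num
    have hdd : d ≤ 1 / d^2 := by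
      rw [le_div_iff₀ (by positivity)]
      calc d * d^2 ≤ 1 * 1^2 := by gcongr
        _ = 1 := by norm_num
    calc _ = A * d * r * ((1+t) ^ (ν+2) * (1+t)^(2*k) * (t ^ (-k) * t ^ (-(3/2) : ℝ)) * Real.exp (-d^2 / (4*c*t) - lam * t)) := by push_cast; ring
      _ ≤ A * d * r * (K2 * (d^2) ^ (-(3/2+k))) := by gcongr
      _ ≤ A * (1/d^2) * r * (K2 * 4 ^ (3/2+k)) := by gcongr
      _ = A * K2 * 4 ^ (3/2+k) * (r / d^2) := by ring
      _ ≤ _ := by linarith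

lemma bh_cauchy (r : ℝ) (hr : 0 < r) :
    Integrable (fun x : ℝ => r / ((1-x)^2 + r^2)) ∧ ∫ x : ℝ, r / ((1-x)^2 + r^2) = Real.pi := by
  have e : (fun x : ℝ => r / ((1-x)^2 + r^2)) = fun x => r⁻¹ * (1 + ((1-x)/r)^2)⁻¹ := by
    funext x
    have : 0 < (1-x)^2 + r^2 := by positivity
    have h2 : (1 + ((1-x)/r)^2) = ((1-x)^2 + r^2) / r^2 := by field_simp; ring
    rw [h2]; field_simp
  rw [e]
  constructor
  · exact (((integrable_inv_one_add_sq.comp_div hr.ne').comp_sub_left 1).const_mul _)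
  · rw [integral_const_mul]
    rw [integral_sub_left_eq_self (fun x : ℝ => (1 + (x/r)^2)⁻¹) volume 1]
    rw [Measure.integral_comp_div (fun x : ℝ => (1 + x^2)⁻¹) r, integral_univ_inv_one_add_sq,
      abs_of_pos hr, smul_eq_mul]
    field_simp

lemma bh_w_int (ν : ℝ) (hν : -1 < ν) : IntegrableOn (fun x : ℝ => x ^ (2*ν+1)) (Set.Ioo 0 1) := by
  have := intervalIntegral.intervalIntegrable_rpow' (a := 0) (b := 1) (r := 2*ν+1) (by linarith)
  rw [intervalIntegrable_iff_integrableOn_Ioo_of_le zero_le_one] at this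
  exact this

lemma bh_fin (ν : ℝ) (hν : -1 < ν) : IsFiniteMeasure (muBessel01 ν) := by
  unfold muBessel01
  exact isFiniteMeasure_withDensity_ofReal (bh_w_int ν hν).2

lemma bh_ae (ν : ℝ) : ∀ᵐ x ∂(muBessel01 ν), x ∈ Set.Ioo (0:ℝ) 1 := by
  unfold muBessel01
  exact (withDensity_absolutelyContinuous _ _).ae_le (ae_restrict_mem measurableSet_Ioo)

lemma bh_integral (ν : ℝ) (g : ℝ → ℝ) :
    ∫ x, g x ∂(muBessel01 ν) = ∫ x in Set.Ioo (0:ℝ) 1, x ^ (2*ν+1) * g x := by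
  unfold muBessel01
  rw [integral_withDensity_eq_integral_toReal_smul (by fun_prop) (by simp)]
  refine setIntegral_congr_fun measurableSet_Ioo ?_
  intro x hx
  have : 0 ≤ x ^ (2*ν+1) := Real.rpow_nonneg hx.1.le _
  simp only [ENNReal.toReal_ofReal this, smul_eq_mul]

lemma bh_w_le (ν x : ℝ) (h : 1/4 ≤ x) (h1 : x ≤ 1) : x ^ (2*ν+1) ≤ 4 ^ |2*ν+1| := by
  apply bh_rpow x 4 _ (by linarith) (by linarith)
  calc x⁻¹ ≤ (1/4:ℝ)⁻¹ := by gcongr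
    _ = 4 := by norm_num

lemma bh_w_ge (ν x : ℝ) (h : 1/4 ≤ x) (h1 : x ≤ 1) : (4 ^ |2*ν+1|)⁻¹ ≤ x ^ (2*ν+1) := by
  have hx : 0 < x := by linarith
  have : x ^ (-(2*ν+1)) ≤ 4 ^ |-(2*ν+1)| := by
    apply bh_rpow x 4 _ (by linarith) (by linarith)
    calc x⁻¹ ≤ (1/4:ℝ)⁻¹ := by gcongr
      _ = 4 := by norm_num
  rw [abs_neg, Real.rpow_neg hx.le] at this
  exact inv_le_of_inv_le₀ (by positivity) this

lemma bh_Iset (j : ℕ) : Iset j = Set.Ioc (1 - (2:ℝ)^(-(j:ℤ))) (1 - (2:ℝ)^(-(j:ℤ))/2) := by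
  unfold Iset
  rw [zpow_sub₀ (by norm_num)]; simp

lemma bh_r (j : ℕ) (hj : j ≠ 0) : (2:ℝ)^(-(j:ℤ)) ≤ 1/2 := by
  calc (2:ℝ)^(-(j:ℤ)) ≤ (2:ℝ)^(-1:ℤ) := by
        apply zpow_le_zpow_right₀ (by norm_num); omega
    _ = 1/2 := by norm_num

lemma bh_meas (ν : ℝ) (hν : -1 < ν) (j : ℕ) (hj : j ≠ 0) :
    ((muBessel01 ν) (Iset j)).toReal⁻¹ ≤ 2 * 4 ^ |2*ν+1| / (2:ℝ)^(-(j:ℤ)) := by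
  have := bh_fin ν hν
  have hr := bh_r j hj
  have hr0 : 0 < (2:ℝ)^(-(j:ℤ)) := by positivity
  rw [bh_Iset]
  set r := (2:ℝ)^(-(j:ℤ))
  set W : ℝ := 4 ^ |2*ν+1| with hW
  have hW0 : 0 < W := by positivity
  have sub : Set.Ioc (1-r) (1-r/2) ⊆ Set.Ioo 0 1 := by
    intro x hx; exact ⟨by linarith [hx.1], by linarith [hx.2]⟩
  have key : W⁻¹ * (r/2) ≤ ((muBessel01 ν) (Set.Ioc (1-r) (1-r/2))).toReal := by
    rw [← ENNReal.ofReal_le_iff_le_toReal (measure_ne_top _ _)]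
    unfold muBessel01
    rw [withDensity_apply _ measurableSet_Ioc, Measure.restrict_restrict measurableSet_Ioc,
      Set.inter_eq_left.mpr sub]
    calc ENNReal.ofReal (W⁻¹ * (r/2)) = ∫⁻ x in Set.Ioc (1-r) (1-r/2), ENNReal.ofReal W⁻¹ := by
          rw [setLIntegral_const, Real.volume_Ioc, ← ENNReal.ofReal_mul (by positivity)]
          congr 2; ring
      _ ≤ _ := by
          refine setLIntegral_mono (by fun_prop) ?_
          intro x hx
          apply ENNReal.ofReal_le_ofReal
          exact bh_w_ge ν x (by linarith [hx.1]) (by linarith [hx.2])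
  calc _ ≤ (W⁻¹ * (r/2))⁻¹ := by gcongr
    _ = _ := by field_simp

theorem bessel_dmu_typeB_atom_maximal (ν lam A c : ℝ)
    (hν : -1 < ν) (hlam : 0 < lam) (hA : 0 < A) (hc : 0 < c) :
    ∃ C : ℝ, 0 < C ∧
    ∀ P : ℝ → ℝ → ℝ → ℝ,
      (∀ t : ℝ, 0 < t → Measurable (fun q : ℝ × ℝ => P t q.1 q.2)) →
      (∀ x ∈ Set.Ioo (0:ℝ) 1, ∀ y ∈ Set.Ioo (0:ℝ) 1, ∀ t : ℝ, 0 < t →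
        0 ≤ P t x y ∧
        P t x y ≤ A * (1+t) ^ (ν+2) * (t + x*y) ^ (-(ν+1/2)) * t ^ (-(1/2) : ℝ) *
          min 1 ((1-x)*(1-y)/t) * Real.exp (-(x-y)^2 / (c*t) - lam * t)) →
      (∀ x ∈ Set.Ioo (0:ℝ) 1, ∀ t : ℝ, 0 < t →
        (∫ y, P t x y ∂(muBessel01 ν)) ≤ A) →
      ∀ j : ℕ,
        ∫ x, (⨆ (t : ℝ) (_ : 0 < t),
            |∫ y, P t x y * (((muBessel01 ν) (Iset j)).toReal⁻¹ *
                Set.indicator (Iset j) (fun _ => (1:ℝ)) y) ∂(muBessel01 ν)|)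
          ∂(muBessel01 ν) ≤ C := by
  have hfin := bh_fin ν hν
  obtain ⟨K1, hK1, Hfar⟩ := bh_far ν lam A c hν hlam hA hc
  set W : ℝ := 4 ^ |2*ν+1| with hW
  have hW0 : 0 < W := by positivity
  set m0 : ℝ := ((muBessel01 ν) (Iset 0)).toReal⁻¹ with hm0
  have hm00 : 0 ≤ m0 := by positivity
  set Q : ℝ := m0 + 2 * W with hQ
  have hQ0 : 0 < Q := by positivity
  set K : ℝ := 5 * (A * Q) + 2 * K1 with hK
  have hK0 : 0 < K := by positivity
  set w0 : ℝ := ∫ x in Set.Ioo (0:ℝ) 1, x ^ (2*ν+1) with hw0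
  have hw00 : 0 ≤ w0 := setIntegral_nonneg measurableSet_Ioo
    (fun x hx => Real.rpow_nonneg hx.1.le _)
  refine ⟨K * (2 * w0 + W * Real.pi), by positivity, ?_⟩
  intro P hmeas hP hPint j
  have hr0 : 0 < (2:ℝ)^(-(j:ℤ)) := by positivity
  have hr1 : (2:ℝ)^(-(j:ℤ)) ≤ 1 := by
    rcases eq_or_ne j 0 with rfl | hj
    · simp
    · linarith [bh_r j hj]
  have hm : ((muBessel01 ν) (Iset j)).toReal⁻¹ ≤ Q / (2:ℝ)^(-(j:ℤ)) := by
    rcases eq_or_ne j 0 with rfl | hj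
    · simp [hQ, ← hm0]; positivity
    · refine (bh_meas ν hν j hj).trans ?_
      gcongr
      rw [hQ]; linarith
  have hI := bh_Iset j
  have hjr := bh_r j
  have hj0 : j = 0 → (2:ℝ)^(-(j:ℤ)) = 1 := by rintro rfl; simp
  have hImeas : MeasurableSet (Iset j) := by rw [hI]; exact measurableSet_Ioc
  set r := (2:ℝ)^(-(j:ℤ)) with hr
  set m := ((muBessel01 ν) (Iset j)).toReal with hmdef
  have hmnn : 0 ≤ m := ENNReal.toReal_nonneg
  have hb : ∀ x ∈ Set.Ioo (0:ℝ) 1, ∀ t : ℝ, 0 < t →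
      |∫ y, P t x y * (m⁻¹ * Set.indicator (Iset j) (fun _ => (1:ℝ)) y) ∂(muBessel01 ν)| ≤
        K * (r / ((1-x)^2 + r^2)) := by
    intro x hx t ht
    have hind : ∀ y, 0 ≤ Set.indicator (Iset j) (fun _ => (1:ℝ)) y := fun y =>
      Set.indicator_nonneg (fun _ _ => zero_le_one) y
    have hnn : 0 ≤ᵐ[muBessel01 ν]
        fun y => P t x y * (m⁻¹ * Set.indicator (Iset j) (fun _ => (1:ℝ)) y) := by
      filter_upwards [bh_ae ν] with y hy
      have := (hP x hx y hy t ht).1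
      have := hind y
      simp only [Pi.zero_apply]
      positivity
    rw [abs_of_nonneg (integral_nonneg_of_ae hnn)]
    have hx0 := hx.1
    have hx1 := hx.2
    have hd0 : 0 < 1 - x := by linarith
    rcases lt_or_ge (1 - 2*r) x with hnear | hfar
    · -- near
      have hint : Integrable (fun y => P t x y) (muBessel01 ν) := by
        refine Integrable.of_bound (((hmeas t ht).comp
          (measurable_const.prodMk measurable_id : Measurable fun y : ℝ => (x, y))).aestronglyMeasurable)
          (A * (1+t) ^ (ν+2) * ((1+t)^2 * t⁻¹) ^ |-(ν+1/2)| * t ^ (-(1/2) : ℝ) * 1 * 1) ?_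
        filter_upwards [bh_ae ν] with y hy
        have h1 := hP x hx y hy t ht
        have hy0 := hy.1
        have hy1 := hy.2
        have hxy0 : 0 < x * y := by positivity
        have hxy : x * y ≤ 1 := by nlinarith
        have hs := bh_rpow (t + x*y) ((1+t)^2 * t⁻¹) (-(ν+1/2)) (by positivity) (by
          have : (1+t)^2 * t⁻¹ = (1+t) + (1+t)/t := by field_simp; ring
          rw [this]; have : 0 < (1+t)/t := by positivity
          linarith) (by
          calc (t+x*y)⁻¹ ≤ t⁻¹ := by gcongr; linarith
            _ = 1 * t⁻¹ := by ring
            _ ≤ _ := by gcongr; nlinarith)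
        have hmin0 : 0 ≤ min 1 ((1-x)*(1-y)/t) := by
          apply le_min zero_le_one
          have : 0 ≤ 1 - y := by linarith
          positivity
        have hexp : Real.exp (-(x-y)^2 / (c*t) - lam * t) ≤ 1 := by
          rw [Real.exp_le_one_iff, neg_div]
          have : 0 ≤ (x-y)^2 / (c*t) := by positivity
          have : 0 < lam * t := by positivity
          linarith
        rw [Real.norm_eq_abs, abs_of_nonneg h1.1]
        refine h1.2.trans ?_
        gcongr
        exact min_le_left _ _
      have s1 : ∫ y, P t x y * (m⁻¹ * Set.indicator (Iset j) (fun _ => (1:ℝ)) y) ∂(muBessel01 ν)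
          ≤ ∫ y, P t x y * m⁻¹ ∂(muBessel01 ν) := by
        refine integral_mono_of_nonneg hnn (hint.mul_const _) ?_
        filter_upwards [bh_ae ν] with y hy
        have h1 := (hP x hx y hy t ht).1
        have : Set.indicator (Iset j) (fun _ => (1:ℝ)) y ≤ 1 :=
          Set.indicator_le_self' (fun _ _ => zero_le_one) y
        have h3 : m⁻¹ * Set.indicator (Iset j) (fun _ => (1:ℝ)) y ≤ m⁻¹ :=
          mul_le_of_le_one_right (by positivity) this
        exact mul_le_mul_of_nonneg_left h3 h1
      rw [integral_mul_const] at s1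
      have s2 : (∫ y, P t x y ∂(muBessel01 ν)) * m⁻¹ ≤ A * (Q / r) := by
        have := hPint x hx t ht
        gcongr
      have s3 : 1 / (5 * r) ≤ r / ((1-x)^2 + r^2) := by
        rw [div_le_div_iff₀ (by positivity) (by positivity)]
        have : 1 - x ≤ 2 * r := by linarith
        nlinarith
      calc _ ≤ A * (Q / r) := s1.trans s2
        _ = 5 * (A * Q) * (1 / (5*r)) := by field_simp
        _ ≤ 5 * (A * Q) * (r / ((1-x)^2 + r^2)) := by gcongr
        _ ≤ K * (r / ((1-x)^2 + r^2)) := by gcongr; rw [hK]; linarith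
    · -- far
      have hj : j ≠ 0 := by
        intro h0
        have := hj0 h0
        linarith
      have hrj := hjr hj
      have s1 : ∫ y, P t x y * (m⁻¹ * Set.indicator (Iset j) (fun _ => (1:ℝ)) y) ∂(muBessel01 ν)
          ≤ ∫ y, (K1 * (r / (1-x)^2) * m⁻¹) * Set.indicator (Iset j) (fun _ => (1:ℝ)) y
              ∂(muBessel01 ν) := by
        refine integral_mono_of_nonneg hnn
          (((integrable_const (1:ℝ)).indicator hImeas).const_mul _) ?_
        filter_upwards [bh_ae ν] with y hy
        by_cases hyI : y ∈ Iset j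
        · simp only [Set.indicator_of_mem hyI, mul_one]
          have h1 := (hP x hx y hy t ht).2
          rw [hI] at hyI
          have h2 := Hfar x y t r hx0 hx1 (by linarith [hyI.1]) hy.2 hr0 hyI.1.le hfar ht
          exact mul_le_mul_of_nonneg_right (h1.trans h2) (by positivity)
        · simp [Set.indicator_of_notMem hyI]
      rw [integral_const_mul, integral_indicator_const _ hImeas] at s1
      have s2 : m⁻¹ * m ≤ 1 := inv_mul_le_one
      have s3 : r / (1-x)^2 ≤ 2 * (r / ((1-x)^2 + r^2)) := by
        rw [← mul_div_assoc, div_le_div_iff₀ (by positivity) (by positivity)]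
        have : r ≤ 1 - x := by linarith
        have : r^2 ≤ (1-x)^2 := by gcongr
        nlinarith
      have s4 : K1 * (r / (1-x)^2) * m⁻¹ * ((muBessel01 ν).real (Iset j) • (1:ℝ)) =
          K1 * (r / (1-x)^2) * (m⁻¹ * m) := by
        rw [Measure.real, ← hmdef, smul_eq_mul]; ring
      rw [s4] at s1
      calc _ ≤ K1 * (r / (1-x)^2) * (m⁻¹ * m) := s1
        _ ≤ K1 * (r / (1-x)^2) * 1 := by gcongr
        _ ≤ K1 * (2 * (r / ((1-x)^2 + r^2))) := by rw [mul_one]; gcongr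
        _ = 2 * K1 * (r / ((1-x)^2 + r^2)) := by ring
        _ ≤ K * (r / ((1-x)^2 + r^2)) := by
          gcongr; rw [hK]
          have : 0 < A * Q := by positivity
          linarith
  rw [bh_integral]
  obtain ⟨ci, cv⟩ := bh_cauchy r hr0
  have hwi := bh_w_int ν hν
  have gi : IntegrableOn (fun x : ℝ => K * (2 * x ^ (2*ν+1) + W * (r / ((1-x)^2 + r^2))))
      (Set.Ioo 0 1) :=
    ((hwi.const_mul 2).add (ci.integrableOn.const_mul W)).const_mul K
  calc _ ≤ ∫ x in Set.Ioo (0:ℝ) 1, K * (2 * x ^ (2*ν+1) + W * (r / ((1-x)^2 + r^2))) := by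
        refine integral_mono_of_nonneg ?_ gi ?_
        · filter_upwards [ae_restrict_mem measurableSet_Ioo] with x hx
          refine mul_nonneg (Real.rpow_nonneg hx.1.le _) ?_
          exact Real.iSup_nonneg fun t => Real.iSup_nonneg fun _ => abs_nonneg _
        · filter_upwards [ae_restrict_mem measurableSet_Ioo] with x hx
          have hw : 0 ≤ x ^ (2*ν+1) := Real.rpow_nonneg hx.1.le _
          have hg : 0 ≤ r / ((1-x)^2 + r^2) := by positivity
          have h1 : (⨆ (t : ℝ) (_ : 0 < t),
            |∫ y, P t x y * (m⁻¹ *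
                Set.indicator (Iset j) (fun _ => (1:ℝ)) y) ∂(muBessel01 ν)|) ≤
                K * (r / ((1-x)^2 + r^2)) :=
            Real.iSup_le (fun t => Real.iSup_le (fun ht => hb x hx t ht) (by positivity))
              (by positivity)
          have h2 : x ^ (2*ν+1) * (r / ((1-x)^2 + r^2)) ≤
              2 * x ^ (2*ν+1) + W * (r / ((1-x)^2 + r^2)) := by
            rcases le_or_gt (1/4) x with hx4 | hx4
            · have := mul_le_mul_of_nonneg_right (bh_w_le ν x hx4 hx.2.le) hg
              linarith
            · have h3 : r / ((1-x)^2 + r^2) ≤ 2 := by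
                rw [div_le_iff₀ (by positivity)]
                nlinarith
              have := mul_le_mul_of_nonneg_left h3 hw
              have : 0 ≤ W * (r / ((1-x)^2 + r^2)) := by positivity
              linarith
          calc _ ≤ x ^ (2*ν+1) * (K * (r / ((1-x)^2 + r^2))) := mul_le_mul_of_nonneg_left h1 hw
            _ = K * (x ^ (2*ν+1) * (r / ((1-x)^2 + r^2))) := by ring
            _ ≤ _ := by gcongr
    _ = K * (2 * w0 + W * ∫ x in Set.Ioo (0:ℝ) 1, r / ((1-x)^2 + r^2)) := by
        rw [integral_const_mul, integral_add (hwi.const_mul 2) (ci.integrableOn.const_mul W),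
          integral_const_mul, integral_const_mul]
    _ ≤ _ := by
        gcongr
        rw [← cv]
        exact setIntegral_le_integral ci (Filter.Eventually.of_forall fun x => by
          simp only [Pi.zero_apply]; positivity)
end

section
/- Let ν > −1 and λ > 0, and let μ_ν be the measure on (0,1) with density x^{2ν+1} with respect to Lebesgue measure. Then there exist constants C, c > 0, depending only on ν and λ, such that for all x, y ∈ (0,1) and t > 0: (1+t)^{ν+2} (t+xy)^{−(ν+1/2)} t^{−1/2} e^{−(x−y)²/(4t) − λt} ≤ C μ_ν(I_{√t}(x))^{−1} e^{−(x−y)²/(ct)}, where I_{√t}(x) = (x−√t, x+√t) ∩ (0,1). -/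
open MeasureTheory

lemma bes_pow_le (a w T : ℝ) (hw : 0 < w) (h1 : w ≤ T) (h2 : w⁻¹ ≤ T) :
    w ^ a ≤ T ^ |a| := by
  rcases le_total 0 a with h | h
  · rw [abs_of_nonneg h]
    exact Real.rpow_le_rpow hw.le h1 h
  · rw [abs_of_nonpos h]
    have : w ^ a = (w⁻¹) ^ (-a) := by
      rw [Real.inv_rpow hw.le, Real.rpow_neg hw.le, inv_inv]
    rw [this]
    exact Real.rpow_le_rpow (inv_pos.mpr hw).le h2 (by linarith)

lemma bes_pow_le_mul (a u v T : ℝ) (hu : 0 < u) (hv : 0 < v) (h1 : u ≤ T * v) (h2 : v ≤ T * u) :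
    u ^ a ≤ T ^ |a| * v ^ a := by
  have h := bes_pow_le a (u / v) T (div_pos hu hv) (by rwa [div_le_iff₀ hv])
    (by rw [inv_div]; rwa [div_le_iff₀ hu])
  rw [Real.div_rpow hu.le hv.le, div_le_iff₀ (Real.rpow_pos_of_pos hv a)] at h
  exact h

lemma bes_exp (p k : ℝ) (hk : 0 < k) :
    ∃ K : ℝ, 0 < K ∧ ∀ u : ℝ, 0 ≤ u → (1 + u) ^ p ≤ K * Real.exp (k * u) := by
  obtain ⟨n, hn⟩ := exists_nat_ge p
  refine ⟨(n.factorial / k ^ n) * Real.exp k, by positivity, fun u hu => ?_⟩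
  have h1 : (1 + u) ^ p ≤ (1 + u) ^ n := by
    rw [← Real.rpow_natCast]
    exact Real.rpow_le_rpow_of_exponent_le (by linarith) hn
  have h2 := Real.pow_div_factorial_le_exp (k * (1 + u)) (by positivity) n
  refine h1.trans ?_
  rw [mul_assoc, ← Real.exp_add, show k + k * u = k * (1 + u) by ring]
  rw [mul_pow, div_le_iff₀ (by positivity)] at h2
  rw [div_mul_eq_mul_div, le_div_iff₀ (by positivity)]
  linarith

lemma bes_mu (ν : ℝ) (A : Set ℝ) (hA : MeasurableSet A) :
    muBessel01 ν (A ∩ Set.Ioo 0 1) = ∫⁻ z in A ∩ Set.Ioo 0 1, ENNReal.ofReal (z ^ (2*ν+1)) := by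
  rw [muBessel01, withDensity_apply _ (hA.inter measurableSet_Ioo),
    Measure.restrict_restrict (hA.inter measurableSet_Ioo), Set.inter_assoc, Set.inter_self]

lemma bes_mu_le (ν : ℝ) (hν : -1 < ν) (A : Set ℝ) (hA : MeasurableSet A) (r : ℝ) (hr : 0 ≤ r)
    (h : A ∩ Set.Ioo 0 1 ⊆ Set.Ioc 0 r) :
    muBessel01 ν (A ∩ Set.Ioo 0 1) ≤ ENNReal.ofReal (r ^ (2*ν+2) / (2*ν+2)) := by
  rw [bes_mu ν A hA]
  refine (lintegral_mono_set h).trans ?_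
  have hi : IntervalIntegrable (fun z : ℝ => z ^ (2*ν+1)) volume 0 r :=
    intervalIntegral.intervalIntegrable_rpow' (by linarith)
  rw [← ofReal_integral_eq_lintegral_ofReal]
  · rw [← intervalIntegral.integral_of_le hr, integral_rpow (Or.inl (by linarith)),
      show 2*ν+1+1 = 2*ν+2 by ring, Real.zero_rpow (by linarith), sub_zero]
  · exact (intervalIntegrable_iff_integrableOn_Ioc_of_le hr).1 hi
  · filter_upwards [ae_restrict_mem measurableSet_Ioc] with z hz
    exact Real.rpow_nonneg hz.1.le _

lemma bes_mu_le2 (ν x s : ℝ) (hs : 0 < s) (hx : 2 * s ≤ x) :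
    muBessel01 ν (Set.Ioo (x - s) (x + s) ∩ Set.Ioo 0 1) ≤
      ENNReal.ofReal (3 ^ |2*ν+1| * (x+s) ^ (2*ν+1) * (2 * s)) := by
  rw [bes_mu ν _ measurableSet_Ioo]
  refine (lintegral_mono_set Set.inter_subset_left).trans ?_
  refine (setLIntegral_mono (g := fun _ => ENNReal.ofReal (3 ^ |2*ν+1| * (x+s) ^ (2*ν+1)))
    measurable_const ?_).trans ?_
  · intro z hz
    apply ENNReal.ofReal_le_ofReal
    apply bes_pow_le_mul <;> linarith [hz.1, hz.2]
  · rw [setLIntegral_const, Real.volume_Ioo, ← ENNReal.ofReal_mul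
      (mul_nonneg (by positivity) (Real.rpow_nonneg (by linarith) _))]
    apply le_of_eq
    congr 2
    ring

lemma bes_mu_pos (ν x s : ℝ) (hs : 0 < s) (hx : x ∈ Set.Ioo (0:ℝ) 1) :
    0 < muBessel01 ν (Set.Ioo (x - s) (x + s) ∩ Set.Ioo 0 1) := by
  rw [bes_mu ν _ measurableSet_Ioo]
  have hm : Measurable fun z : ℝ => ENNReal.ofReal (z ^ (2*ν+1)) := by fun_prop
  rw [setLIntegral_pos_iff hm]
  have ho : IsOpen (Set.Ioo (x - s) (x + s) ∩ Set.Ioo 0 1) := isOpen_Ioo.inter isOpen_Ioo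
  have hp := ho.measure_pos volume ⟨x, ⟨by linarith, by linarith⟩, hx⟩
  refine hp.trans_le (measure_mono fun z hz => ⟨?_, hz⟩)
  have : 0 < z ^ (2*ν+1) := Real.rpow_pos_of_pos hz.2.1 _
  simpa [Function.mem_support] using this

lemma bes_mu_real (ν : ℝ) (hν : -1 < ν) : ∃ D : ℝ, 0 < D ∧ ∀ x ∈ Set.Ioo (0:ℝ) 1, ∀ s : ℝ, 0 < s →
    (muBessel01 ν (Set.Ioo (x - s) (x + s) ∩ Set.Ioo 0 1)).toReal ≤ D * s * (x+s) ^ (2*ν+1) := by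
  have hd : 0 < 2*ν+2 := by linarith
  refine ⟨2 * 3 ^ |2*ν+1| + 3 / (2*ν+2), by positivity, fun x hx s hs => ?_⟩
  have hxs : 0 < x + s := by linarith [hx.1]
  have hP : 0 < (x+s) ^ (2*ν+1) := Real.rpow_pos_of_pos hxs _
  rcases le_total (2*s) x with h | h
  · refine (ENNReal.toReal_le_of_le_ofReal (by positivity) (bes_mu_le2 ν x s hs h)).trans ?_
    have : 0 ≤ 3 / (2*ν+2) * s * (x+s) ^ (2*ν+1) := by positivity
    linarith
  · refine (ENNReal.toReal_le_of_le_ofReal (by positivity) (bes_mu_le ν hν _ measurableSet_Ioo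
      (x+s) hxs.le (fun z hz => ⟨hz.2.1, hz.1.2.le⟩))).trans ?_
    rw [show 2*ν+2 = (2*ν+1) + 1 by ring, Real.rpow_add_one hxs.ne']
    rw [show 2*ν+2 = (2*ν+1) + 1 by ring] at hd
    have h1 : (x+s) ^ (2*ν+1) * (x+s) / (2*ν+1+1) ≤ (x+s) ^ (2*ν+1) * (3*s) / (2*ν+1+1) := by
      gcongr
      linarith
    have : 0 ≤ 2 * 3 ^ |2*ν+1| * s * (x+s) ^ (2*ν+1) := by positivity
    refine h1.trans ?_
    have e : (x+s) ^ (2*ν+1) * (3*s) / (2*ν+1+1) = 3 / (2*ν+1+1) * s * (x+s) ^ (2*ν+1) := by ring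
    rw [e]
    linarith

lemma bes_ratio (x y s : ℝ) (hx : 0 < x) (hy : 0 < y) (hs : 0 < s) :
    (x+s)^2 ≤ 6 * (1 + (x-y)^2/s^2) * (s^2 + x*y) ∧ s^2 + x*y ≤ 6 * (1 + (x-y)^2/s^2) * (x+s)^2 := by
  have hxy := mul_pos hx hy
  have hxs := mul_pos hx hs
  have e : (x-y)^2 = (x-y)^2/s^2 * s^2 := by field_simp
  have hq : 0 ≤ (x-y)^2/s^2 := by positivity
  generalize (x-y)^2/s^2 = q at *
  constructor
  · nlinarith [sq_nonneg (x-s), sq_nonneg y, mul_nonneg hq hxy.le]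
  · nlinarith [sq_nonneg (x-y), mul_nonneg hq hxs.le, mul_nonneg hq (sq_nonneg x), sq_nonneg (2*x-y), sq_nonneg (3*x - y)]

/-- The two-sided heat-kernel bound for the Fourier–Bessel
operator on `((0,1), dμ_ν)` implies a Gaussian upper bound of the form
`C μ_ν(I_{√t}(x))^{-1} e^{-(x-y)²/(ct)}`. -/
theorem bessel_dmu_gaussian_upper_bound (ν lam : ℝ) (hν : -1 < ν) (hlam : 0 < lam) :
    ∃ C c : ℝ, 0 < C ∧ 0 < c ∧
      ∀ x ∈ Set.Ioo (0:ℝ) 1, ∀ y ∈ Set.Ioo (0:ℝ) 1, ∀ t : ℝ, 0 < t →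
        (1+t) ^ (ν+2) * (t + x*y) ^ (-(ν+1/2)) * t ^ (-(1/2) : ℝ) *
            Real.exp (-(x-y)^2 / (4*t) - lam * t)
          ≤ C * (((muBessel01 ν) (Set.Ioo (x - Real.sqrt t) (x + Real.sqrt t)
                ∩ Set.Ioo 0 1)).toReal)⁻¹ * Real.exp (-(x-y)^2 / (c*t)) := by
  obtain ⟨D, hD, hM⟩ := bes_mu_real ν hν
  obtain ⟨K, hK, hKe⟩ := bes_exp |ν+1/2| (1/8) (by norm_num)
  obtain ⟨L, hL, hLe⟩ := bes_exp (ν + 2 + |ν+1/2|) lam hlam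
  have hd : 0 < 2*ν+2 := by linarith
  have h2 : (0:ℝ) < 2 ^ (ν+2) := by positivity
  have h6 : (0:ℝ) < 6 ^ |ν+1/2| := by positivity
  refine ⟨L / (2*ν+2) + 2 ^ (ν+2) * (D * (6 ^ |ν+1/2| * K)), 8, by positivity, by norm_num, ?_⟩
  intro x hx y hy t ht
  have hs : 0 < √t := Real.sqrt_pos.2 ht
  have hst : √t ^ 2 = t := Real.sq_sqrt ht.le
  have hx0 : 0 < x := hx.1
  have hy0 : 0 < y := hy.1
  have hxy : 0 < x * y := mul_pos hx.1 hy.1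
  have hxy1 : x * y < 1 := by nlinarith [hx.1, hx.2, hy.1, hy.2]
  have hM1 := bes_mu_le ν hν (Set.Ioo (x - √t) (x + √t)) measurableSet_Ioo 1 zero_le_one
    (fun z hz => ⟨hz.2.1, hz.2.2.le⟩)
  have hMpos := bes_mu_pos ν x (√t) hs hx
  have hM2 := hM x hx (√t) hs
  have hM3 := ENNReal.toReal_le_of_le_ofReal (by positivity) hM1
  have hM0 := ENNReal.toReal_pos hMpos.ne' (hM1.trans_lt ENNReal.ofReal_lt_top).ne
  generalize ((muBessel01 ν) (Set.Ioo (x - √t) (x + √t) ∩ Set.Ioo 0 1)).toReal = M at *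
  clear hM1 hMpos hM
  rw [Real.one_rpow] at hM3
  rw [mul_right_comm _ M⁻¹, ← div_eq_mul_inv, le_div_iff₀ hM0]
  have htp : 0 < t + x * y := by positivity
  rcases le_total 1 t with h1 | h1
  · have a1 : (t + x*y) ^ (-(ν+1/2)) ≤ (1 + t) ^ |ν+1/2| := by
      rw [← abs_neg]
      apply bes_pow_le _ _ _ htp (by linarith)
      exact (inv_le_one_of_one_le₀ (by linarith)).trans (by linarith)
    have a2 : t ^ (-(1/2) : ℝ) ≤ 1 := Real.rpow_le_one_of_one_le_of_nonpos h1 (by norm_num)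
    have a3 : Real.exp (-(x-y)^2 / (4*t) - lam * t) ≤
        Real.exp (-(x-y)^2 / (8*t)) * Real.exp (-(lam * t)) := by
      rw [← Real.exp_add]
      apply Real.exp_le_exp.2
      have : 0 ≤ (x-y)^2/(8*t) := by positivity
      have e : -(x-y)^2/(4*t) = -(x-y)^2/(8*t) - (x-y)^2/(8*t) := by field_simp; ring
      linarith
    have a4 := hLe t ht.le
    rw [Real.rpow_add (by linarith)] at a4
    have hE : Real.exp (lam * t) * Real.exp (-(lam * t)) = 1 := by
      rw [← Real.exp_add]; simp
    calc _ ≤ (1+t) ^ (ν+2) * (1 + t) ^ |ν+1/2| * 1 *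
          (Real.exp (-(x-y)^2 / (8*t)) * Real.exp (-(lam * t))) * (1 / (2*ν+2)) := by gcongr
      _ = ((1+t) ^ (ν+2) * (1 + t) ^ |ν+1/2|) *
          (Real.exp (-(x-y)^2 / (8*t)) * Real.exp (-(lam * t))) * (1 / (2*ν+2)) := by ring
      _ ≤ (L * Real.exp (lam * t)) *
          (Real.exp (-(x-y)^2 / (8*t)) * Real.exp (-(lam * t))) * (1 / (2*ν+2)) := by gcongr
      _ = L / (2*ν+2) * Real.exp (-(x-y)^2 / (8*t)) *
          (Real.exp (lam * t) * Real.exp (-(lam * t))) := by ring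
      _ = L / (2*ν+2) * Real.exp (-(x-y)^2 / (8*t)) := by rw [hE, mul_one]
      _ ≤ _ := by
        gcongr
        have : 0 < 2 ^ (ν+2) * (D * (6 ^ |ν+1/2| * K)) := by positivity
        linarith
  · have hxs : 0 < x + √t := by positivity
    obtain ⟨r1, r2⟩ := bes_ratio x y (√t) hx0 hy0 hs
    rw [hst] at r1 r2
    have hu : 0 ≤ (x-y)^2/t := by positivity
    have b1 := bes_pow_le_mul (ν+1/2) _ _ _ (by positivity) htp r1 r2
    have b2 : ((x + √t)^2) ^ (ν+1/2) = (x + √t) ^ (2*ν+1) := by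
      rw [← Real.rpow_natCast, ← Real.rpow_mul hxs.le]
      congr 1; push_cast; ring
    rw [b2, Real.mul_rpow (by norm_num) (by linarith)] at b1
    have b3 := hKe _ hu
    have b4 : (1+t) ^ (ν+2) ≤ 2 ^ (ν+2) :=
      Real.rpow_le_rpow (by linarith) (by linarith) (by linarith)
    have b5 : Real.exp (-(x-y)^2 / (4*t) - lam * t) ≤ Real.exp (-(x-y)^2 / (4*t)) := by
      apply Real.exp_le_exp.2
      have := mul_pos hlam ht
      linarith
    have b6 : Real.exp (1/8 * ((x-y)^2/t)) * Real.exp (-(x-y)^2 / (4*t)) =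
        Real.exp (-(x-y)^2 / (8*t)) := by
      rw [← Real.exp_add]
      congr 1; field_simp; ring
    have b7 : t ^ (-(1/2) : ℝ) * √t = 1 := by
      rw [Real.sqrt_eq_rpow, ← Real.rpow_add ht]; norm_num
    have b8 : (t + x*y) ^ (-(ν+1/2)) * (t + x*y) ^ (ν+1/2) = 1 := by
      rw [← Real.rpow_add htp]; norm_num
    have b9 : M ≤ D * √t * (6 ^ |ν+1/2| * (K * Real.exp (1/8 * ((x-y)^2/t))) *
        (t + x*y) ^ (ν+1/2)) := by
      refine hM2.trans ?_
      gcongr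
      refine b1.trans ?_
      gcongr
    calc _ ≤ 2 ^ (ν+2) * (t + x*y) ^ (-(ν+1/2)) * t ^ (-(1/2) : ℝ) *
            Real.exp (-(x-y)^2 / (4*t)) * (D * √t * (6 ^ |ν+1/2| *
            (K * Real.exp (1/8 * ((x-y)^2/t))) * (t + x*y) ^ (ν+1/2))) := by gcongr
      _ = 2 ^ (ν+2) * (D * (6 ^ |ν+1/2| * K)) *
          (Real.exp (1/8 * ((x-y)^2/t)) * Real.exp (-(x-y)^2 / (4*t))) *
          (t ^ (-(1/2) : ℝ) * √t) * ((t + x*y) ^ (-(ν+1/2)) * (t + x*y) ^ (ν+1/2)) := by ring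
      _ = 2 ^ (ν+2) * (D * (6 ^ |ν+1/2| * K)) * Real.exp (-(x-y)^2 / (8*t)) := by
        rw [b6, b7, b8, mul_one, mul_one]
      _ ≤ _ := by
        gcongr
        have : 0 < L / (2*ν+2) := by positivity
        linarith
end

section
/- Let n ≥ 1, p ∈ (0,1], and N > n(1−p)/p. Let B = B(x_B, r_B) ⊂ ℝⁿ be a ball and let a : ℝⁿ → ℝ be measurable with supp a ⊂ B and ‖a‖_∞ ≤ |B|^{−1/p}, where |·| is Lebesgue measure. Let P : (0,∞)×ℝⁿ×ℝⁿ → ℝ be measurable and suppose there are constants A, c > 0 such that |P_t(x,y)| ≤ A t^{−n/2} (r_B/√t)^N e^{−|x−y|²/(ct)} for all t > 0, x ∈ ℝⁿ, and y ∈ B. Then there exists a constant C depending only on A, c, n, p, N (and not on B or a) such that ∫_{ℝⁿ∖4B} ( sup_{t>0} |∫_B P_t(x,y) a(y) dy| )^p dx ≤ C. -/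
open MeasureTheory Metric

lemma aux_exp (s u : ℝ) (hs : 0 < s) (hu : 0 < u) :
    Real.exp (-u) ≤ s ^ s * u ^ (-s) := by
  have h1 : u / s ≤ Real.exp (u / s) := by
    have := Real.add_one_le_exp (u / s); linarith
  have h2 : (u / s) ^ s ≤ Real.exp (u / s) ^ s :=
    Real.rpow_le_rpow (by positivity) h1 hs.le
  rw [← Real.exp_mul, div_mul_cancel₀ _ hs.ne', Real.div_rpow hu.le hs.le] at h2
  have hsp : 0 < s ^ s := Real.rpow_pos_of_pos hs s
  have hup : 0 < u ^ s := Real.rpow_pos_of_pos hu s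
  rw [Real.exp_neg, Real.rpow_neg hu.le, ← div_eq_mul_inv, inv_eq_one_div,
    div_le_div_iff₀ (Real.exp_pos u) hup]
  rw [div_le_iff₀ hsp] at h2
  linarith

lemma aux_kernel (m N c r t e : ℝ) (hM : 0 < m + N) (hc : 0 < c) (hr : 0 < r) (ht : 0 < t)
    (he : 0 < e) :
    t ^ (-(m/2)) * (r / Real.sqrt t) ^ N * Real.exp (-(e^2/(c*t))) ≤
      ((m+N)/2) ^ ((m+N)/2) * c ^ ((m+N)/2) * r ^ N * e ^ (-(m+N)) := by
  have h := aux_exp ((m+N)/2) (e^2/(c*t)) (by linarith) (by positivity)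
  refine (mul_le_mul_of_nonneg_left h (by positivity)).trans (le_of_eq ?_)
  have e1 : (e^2/(c*t)) ^ (-((m+N)/2)) = e ^ (-(m+N)) * c ^ ((m+N)/2) * t ^ ((m+N)/2) := by
    rw [Real.div_rpow (by positivity) (by positivity), Real.mul_rpow hc.le ht.le,
      Real.rpow_neg hc.le, Real.rpow_neg ht.le, ← Real.rpow_natCast e 2, ← Real.rpow_mul he.le]
    have : ((2:ℕ):ℝ) * (-((m+N)/2)) = -(m+N) := by push_cast; ring
    rw [this]
    have := Real.rpow_pos_of_pos hc ((m+N)/2)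
    have := Real.rpow_pos_of_pos ht ((m+N)/2)
    field_simp
  have e2 : (r / Real.sqrt t) ^ N = r ^ N * t ^ (-(N/2)) := by
    rw [Real.div_rpow hr.le (Real.sqrt_nonneg t), Real.sqrt_eq_rpow, ← Real.rpow_mul ht.le,
      div_eq_mul_inv, ← Real.rpow_neg ht.le]
    congr 2; ring
  have e3 : t ^ (-(m/2)) * t ^ (-(N/2)) * t ^ ((m+N)/2) = 1 := by
    rw [← Real.rpow_add ht, ← Real.rpow_add ht]
    rw [show -(m/2) + -(N/2) + (m+N)/2 = 0 by ring, Real.rpow_zero]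
  rw [e1, e2]
  calc _ = ((m+N)/2) ^ ((m+N)/2) * c ^ ((m+N)/2) * r ^ N * e ^ (-(m+N)) *
        (t ^ (-(m/2)) * t ^ (-(N/2)) * t ^ ((m+N)/2)) := by ring
    _ = _ := by rw [e3, mul_one]

lemma aux_power (m N p D r w ω : ℝ) (hD : 0 < D) (hp : 0 < p) (hr : 0 < r) (hw : 0 < w)
    (hω : 0 < ω) :
    (D * r ^ N * (r * w / 2) ^ (-(m+N)) * (ω * r ^ m) ^ (-(1/p)) * (ω * r ^ m)) ^ p =
      (D * 2 ^ (m+N)) ^ p * ω ^ (p-1) * (r ^ m)⁻¹ * w ^ (-((m+N)*p)) := by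
  have hrm : 0 < r ^ m := Real.rpow_pos_of_pos hr m
  apply Real.log_injOn_pos (Set.mem_Ioi.2 (by positivity)) (Set.mem_Ioi.2 (by positivity))
  have h2 : (0:ℝ) < 2 := by norm_num
  have q1 := Real.rpow_pos_of_pos hr N
  have q2 := Real.rpow_pos_of_pos (show 0 < r * w / 2 by positivity) (-(m+N))
  have q3 := Real.rpow_pos_of_pos (show 0 < ω * r ^ m by positivity) (-(1/p))
  have q4 := Real.rpow_pos_of_pos h2 (m+N)
  have q5 := Real.rpow_pos_of_pos (show 0 < D * 2 ^ (m+N) by positivity) p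
  have q6 := Real.rpow_pos_of_pos hω (p-1)
  have q7 := Real.rpow_pos_of_pos hw (-((m+N)*p))
  rw [Real.log_rpow (by positivity), Real.log_mul (by positivity) (by positivity),
    Real.log_mul (by positivity) (by positivity), Real.log_mul (by positivity) (by positivity),
    Real.log_mul (by positivity) (by positivity), Real.log_rpow hr,
    Real.log_rpow (by positivity), Real.log_rpow (by positivity),
    Real.log_mul hω.ne' hrm.ne', Real.log_rpow hr,
    Real.log_div (by positivity) (by positivity), Real.log_mul hr.ne' hw.ne',
    Real.log_mul (by positivity) (by positivity), Real.log_mul (by positivity) (by positivity),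
    Real.log_mul (by positivity) (by positivity), Real.log_inv, Real.log_rpow hr,
    Real.log_rpow (by positivity), Real.log_mul (by positivity) (by positivity),
    Real.log_rpow h2, Real.log_rpow hω, Real.log_rpow hw]
  field_simp
  ring

/-- `L^p` bound away from `4B` for the maximal function of a
non-cancellative `(p,ρ)`-atom on a ball `B`, under a Schrödinger-type Gaussian
kernel bound with decay factor `(r_B/√t)^N`, `N > n(1-p)/p`. -/
theorem schrodinger_atom_away_estimate (n : ℕ) (hn : 1 ≤ n) (p N A c : ℝ)
    (hp : p ∈ Set.Ioc (0:ℝ) 1) (hN : (n:ℝ) * (1 - p) / p < N)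
    (hA : 0 < A) (hc : 0 < c) :
    ∃ C : ℝ, 0 < C ∧
    ∀ (xB : EuclideanSpace ℝ (Fin n)) (rB : ℝ), 0 < rB →
    ∀ a : EuclideanSpace ℝ (Fin n) → ℝ, Measurable a →
      Function.support a ⊆ ball xB rB →
      (∀ y, |a y| ≤ (volume (ball xB rB)).toReal ^ (-(1/p))) →
    ∀ P : ℝ → EuclideanSpace ℝ (Fin n) → EuclideanSpace ℝ (Fin n) → ℝ,
      (∀ t : ℝ, 0 < t →
        Measurable (fun q : EuclideanSpace ℝ (Fin n) × EuclideanSpace ℝ (Fin n) =>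
          P t q.1 q.2)) →
      (∀ t : ℝ, 0 < t → ∀ x : EuclideanSpace ℝ (Fin n), ∀ y ∈ ball xB rB,
        |P t x y| ≤ A * t ^ (-((n:ℝ)/2)) * (rB / Real.sqrt t) ^ N *
          Real.exp (-(dist x y)^2 / (c*t))) →
      ∫ x in (ball xB (4*rB))ᶜ,
        (⨆ (t : ℝ) (_ : 0 < t),
          |∫ y in ball xB rB, P t x y * a y|) ^ p ≤ C := by
  obtain ⟨hp0, hp1⟩ := hp
  have hn0 : (0:ℝ) < n := by exact_mod_cast hn
  have hMp : (n:ℝ) < (n + N) * p := by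
    rw [div_lt_iff₀ hp0] at hN; linarith
  have hM : 0 < (n:ℝ) + N := by
    by_contra h
    have := mul_nonpos_of_nonpos_of_nonneg (not_lt.1 h) hp0.le
    linarith
  set s : ℝ := ((n:ℝ)+N)/2 with hs
  have hs0 : 0 < s := by positivity
  set D : ℝ := A * (s ^ s * c ^ s) with hD
  have hD0 : 0 < D := by positivity
  set ω : ℝ := (volume (ball (0 : EuclideanSpace ℝ (Fin n)) 1)).toReal with hω
  have hω0 : 0 < ω :=
    ENNReal.toReal_pos (measure_ball_pos _ _ one_pos).ne' measure_ball_lt_top.ne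
  set G : EuclideanSpace ℝ (Fin n) → ℝ := fun z => (1 + ‖z‖) ^ (-(((n:ℝ)+N)*p)) with hG
  have hGi : Integrable G := integrable_one_add_norm (by simpa using hMp)
  have hG0 : ∀ z, 0 ≤ G z := fun z => by positivity
  set K : ℝ := (D * 2 ^ ((n:ℝ)+N)) ^ p * ω ^ (p-1) with hK
  have hK0 : 0 < K := by positivity
  refine ⟨K * (∫ z, G z) + 1, by
    have : 0 ≤ ∫ z, G z := integral_nonneg hG0
    positivity, ?_⟩
  intro x₀ r hr a _ _ hab P _ hP
  have hV : (volume (ball x₀ r)).toReal = ω * r ^ (n:ℝ) := by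
    rw [Measure.addHaar_ball_of_pos _ _ hr, ENNReal.toReal_mul, ENNReal.toReal_ofReal (by positivity)]
    simp [hω, mul_comm]
  have hrn : 0 < r ^ (n:ℝ) := Real.rpow_pos_of_pos hr _
  set H : EuclideanSpace ℝ (Fin n) → ℝ :=
    fun x => K * (r ^ (n:ℝ))⁻¹ * G (r⁻¹ • (x - x₀)) with hH
  have hHi : Integrable H := by
    refine Integrable.const_mul ?_ _
    exact (hGi.comp_smul (inv_ne_zero hr.ne')).comp_sub_right x₀
  have hH0 : ∀ x, 0 ≤ H x := fun x => by have := hG0 (r⁻¹ • (x - x₀)); positivity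
  have hHint : ∫ x, H x = K * ∫ z, G z := by
    simp only [hH]
    rw [integral_const_mul, integral_sub_right_eq_self (fun x => G (r⁻¹ • x)) x₀,
      Measure.integral_comp_inv_smul]
    simp only [finrank_euclideanSpace, Fintype.card_fin, smul_eq_mul, ← Real.rpow_natCast]
    rw [abs_of_pos hrn]
    field_simp
  have key : ∀ x ∈ (ball x₀ (4*r))ᶜ,
      (⨆ (t : ℝ) (_ : 0 < t), |∫ y in ball x₀ r, P t x y * a y|) ^ p ≤ H x := by
    intro x hx
    have hx4 : 4 * r ≤ dist x x₀ := by simpa using hx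
    set w : ℝ := 1 + ‖r⁻¹ • (x - x₀)‖ with hw
    have hw0 : 0 < w := by positivity
    have hrw : r * w = r + dist x x₀ := by
      rw [hw, norm_smul, Real.norm_of_nonneg (by positivity), dist_eq_norm]
      field_simp
    have hsup : (⨆ (t : ℝ) (_ : 0 < t), |∫ y in ball x₀ r, P t x y * a y|) ≤
        D * r ^ N * (r * w / 2) ^ (-((n:ℝ)+N)) * (ω * r ^ (n:ℝ)) ^ (-(1/p)) *
          (ω * r ^ (n:ℝ)) := by
      refine Real.iSup_le (fun t => Real.iSup_le (fun ht => ?_) (by positivity)) (by positivity)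
      have hb := norm_setIntegral_le_of_norm_le_const (μ := volume) (s := ball x₀ r)
        (f := fun y => P t x y * a y)
        (C := D * r ^ N * (r * w / 2) ^ (-((n:ℝ)+N)) * (ω * r ^ (n:ℝ)) ^ (-(1/p)))
        measure_ball_lt_top ?_
      · rw [Measure.real, hV, Real.norm_eq_abs] at hb
        exact hb
      · intro y hy
        rw [norm_mul, Real.norm_eq_abs, Real.norm_eq_abs]
        refine mul_le_mul ?_ (by rw [← hV]; exact hab y) (abs_nonneg _) (by positivity)
        refine (hP t ht x y hy).trans ?_
        have hdist : r * w / 2 ≤ dist x y := by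
          have h1 := dist_triangle x y x₀
          have h2 : dist y x₀ < r := hy
          linarith
        have hk := aux_kernel n N c r t (r*w/2) hM hc hr ht (by positivity)
        have hexp : Real.exp (-(dist x y)^2 / (c*t)) ≤ Real.exp (-((r*w/2)^2/(c*t))) := by
          rw [Real.exp_le_exp, neg_div, neg_le_neg_iff]
          gcongr
        calc _ ≤ A * t ^ (-((n:ℝ)/2)) * (r / Real.sqrt t) ^ N *
              Real.exp (-((r*w/2)^2/(c*t))) := by gcongr
          _ = A * (t ^ (-((n:ℝ)/2)) * (r / Real.sqrt t) ^ N *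
              Real.exp (-((r*w/2)^2/(c*t)))) := by ring
          _ ≤ _ := mul_le_mul_of_nonneg_left hk hA.le
          _ = _ := by rw [hD, hs]; ring
    refine (Real.rpow_le_rpow ?_ hsup hp0.le).trans (le_of_eq ?_)
    · exact Real.iSup_nonneg fun t => Real.iSup_nonneg fun _ => abs_nonneg _
    · rw [aux_power n N p D r w ω hD0 hp0 hr hw0 hω0]
  calc _ ≤ ∫ x in (ball x₀ (4*r))ᶜ, H x := by
        refine integral_mono_of_nonneg ?_ hHi.integrableOn ?_
        · exact Filter.Eventually.of_forall fun x => Real.rpow_nonneg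
            (Real.iSup_nonneg fun t => Real.iSup_nonneg fun _ => abs_nonneg _) _
        · exact (ae_restrict_iff' measurableSet_ball.compl).2 (Filter.Eventually.of_forall key)
    _ ≤ ∫ x, H x := setIntegral_le_integral hHi (Filter.Eventually.of_forall hH0)
    _ ≤ _ := by rw [hHint]; linarith
end
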